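/- arXiv:1402.1273 — 5 statements merged into one kernel-verified Lean document; each statement's English description precedes it below -/
import Mathlib

section
/- Let A be a left-artinian ring with a ℤ-grading. Then there exists a complete system of primitive pairwise orthogonal idempotents in A all of whose elements are homogeneous of degree 0 with respect to the grading. -/
/-- An idempotent `e` in a ring is *primitive* if it is nonzero and cannot be
written as the sum of two nonzero orthogonal idempotents. -/
def IsPrimitiveIdempotent {A : Type*} [Ring A] (e : A) : Prop :=
  IsIdempotentElem e ∧ e ≠ 0 ∧
    ∀ a b : A, IsIdempotentElem a → IsIdempotentElem b →
      a * b = 0 → b * a = 0 → e = a + b → a = 0 ∨ b = 0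

section GradedCorner

variable {A : Type*} [Ring A] (𝒜 : ℤ → AddSubgroup A)

/-- A nonzero idempotent of degree `0` that is not the sum of two nonzero orthogonal idempotents
of degree `0`. -/
structure IsGradedPrimitiveIdempotent (e : A) : Prop where
  mem : e ∈ 𝒜 0
  idem : IsIdempotentElem e
  ne_zero : e ≠ 0
  eq_zero_or : ∀ a ∈ 𝒜 0, ∀ b ∈ 𝒜 0, IsIdempotentElem a → IsIdempotentElem b →
    a * b = 0 → b * a = 0 → e = a + b → a = 0 ∨ b = 0

/-- The degree `i` part of the corner `e * A * e`. -/
def gradedCorner (e : A) (i : ℤ) : AddSubgroup A where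
  carrier := {x | x ∈ 𝒜 i ∧ e * x = x ∧ x * e = x}
  add_mem' := fun ⟨hx, hex, hxe⟩ ⟨hy, hey, hye⟩ =>
    ⟨add_mem hx hy, by rw [mul_add, hex, hey], by rw [add_mul, hxe, hye]⟩
  zero_mem' := ⟨zero_mem _, mul_zero _, zero_mul _⟩
  neg_mem' := fun ⟨hx, hex, hxe⟩ =>
    ⟨neg_mem hx, by rw [mul_neg, hex], by rw [neg_mul, hxe]⟩

variable {𝒜} {e : A}

/-- Every degree `0` idempotent of a left artinian graded ring is a sum of pairwise orthogonal
idempotents that are primitive in degree `0`. -/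
theorem exists_sum_gradedPrimitiveIdempotent_eq [IsArtinian A A] (e : A) (he : e ∈ 𝒜 0)
    (hi : IsIdempotentElem e) :
    ∃ (ι : Type) (_ : Fintype ι) (p : ι → A), (∀ x, IsGradedPrimitiveIdempotent 𝒜 (p x)) ∧
      (∀ x y, x ≠ y → p x * p y = 0) ∧ (∀ x, e * p x = p x ∧ p x * e = p x) ∧ ∑ x, p x = e := by
  generalize hL : Submodule.span A {e} = L
  induction L using WellFoundedLT.induction generalizing e with
  | ind L ih =>
    subst hL
    by_cases h0 : e = 0
    · exact ⟨Empty, inferInstance, Empty.elim, by simp, by simp, by simp, by simp [h0]⟩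
    by_cases hp : IsGradedPrimitiveIdempotent 𝒜 e
    · exact ⟨Unit, inferInstance, fun _ => e, fun _ => hp, fun x y h => (h rfl).elim,
        fun _ => ⟨hi, hi⟩, by simp⟩
    obtain ⟨a, ha, b, hb, hai, hbi, hab, hba, heab, ha0, hb0⟩ : ∃ a ∈ 𝒜 0, ∃ b ∈ 𝒜 0,
        IsIdempotentElem a ∧ IsIdempotentElem b ∧ a * b = 0 ∧ b * a = 0 ∧ e = a + b ∧
          a ≠ 0 ∧ b ≠ 0 := by
      by_contra! h
      exact hp ⟨he, hi, h0, fun a ha b hb h1 h2 h3 h4 h5 =>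
        or_iff_not_imp_left.2 (h a ha b hb h1 h2 h3 h4 h5)⟩
    have hlt : ∀ c d : A, IsIdempotentElem c → c * d = 0 → d * c = 0 → e = c + d → d ≠ 0 →
        IsIdempotentElem d → Submodule.span A {c} < Submodule.span A {e} := by
      intro c d hc hcd hdc hecd hd hdi
      refine lt_of_le_not_ge ((Submodule.span_singleton_le_iff_mem _ _).2
        (Submodule.mem_span_singleton.2 ⟨c, by
          rw [smul_eq_mul, hecd, mul_add, hc.eq, hcd, add_zero]⟩)) fun hle => hd ?_
      obtain ⟨r, hr⟩ := Submodule.mem_span_singleton.1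
        ((Submodule.span_singleton_le_iff_mem _ _).1 hle)
      rw [smul_eq_mul] at hr
      calc d = e * d := by rw [hecd, add_mul, hcd, hdi.eq, zero_add]
        _ = 0 := by rw [← hr, mul_assoc, hcd, mul_zero]
    obtain ⟨ι, _, p, hp1, hp2, hp3, hp4⟩ :=
      ih _ (hlt a b hai hab hba heab hb0 hbi) a ha hai rfl
    obtain ⟨κ, _, q, hq1, hq2, hq3, hq4⟩ :=
      ih _ (hlt b a hbi hba hab (by rw [heab, add_comm]) ha0 hai) b hb hbi rfl
    refine ⟨ι ⊕ κ, inferInstance, Sum.elim p q, ?_, ?_, ?_, ?_⟩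
    · rintro (x | x)
      exacts [hp1 x, hq1 x]
    · rintro (x | x) (y | y) h
      · exact hp2 x y fun h' => h (congrArg _ h')
      · change p x * q y = 0
        rw [← (hp3 x).2, ← (hq3 y).1, mul_assoc, ← mul_assoc a, hab, zero_mul, mul_zero]
      · change q x * p y = 0
        rw [← (hq3 x).2, ← (hp3 y).1, mul_assoc, ← mul_assoc b, hba, zero_mul, mul_zero]
      · exact hq2 x y fun h' => h (congrArg _ h')
    · rintro (x | x)
      · change e * p x = p x ∧ p x * e = p x
        rw [heab, add_mul, mul_add, (hp3 x).1, (hp3 x).2]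
        constructor
        · rw [← (hp3 x).1, ← mul_assoc b, hba, zero_mul, add_zero]
        · rw [← (hp3 x).2, mul_assoc _ a b, hab, mul_zero, add_zero]
      · change e * q x = q x ∧ q x * e = q x
        rw [heab, add_mul, mul_add, (hq3 x).1, (hq3 x).2]
        constructor
        · rw [← (hq3 x).1, ← mul_assoc a, hab, zero_mul, zero_add]
        · rw [← (hq3 x).2, mul_assoc _ b a, hba, mul_zero, zero_add]
    · rw [Fintype.sum_sum_type, heab]
      simp only [Sum.elim_inl, Sum.elim_inr, hp4, hq4]

variable [GradedRing 𝒜]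

theorem GradedRing.proj_mem (i : ℤ) (a : A) : GradedRing.proj 𝒜 i a ∈ 𝒜 i :=
  SetLike.coe_mem _

theorem GradedRing.proj_mul_of_left_mem {i : ℤ} {a : A} (ha : a ∈ 𝒜 i) (n : ℤ) (b : A) :
    GradedRing.proj 𝒜 n (a * b) = a * GradedRing.proj 𝒜 (n - i) b := by
  have h := DirectSum.coe_decompose_mul_add_of_left_mem 𝒜 (j := n - i) (b := b) ha
  rwa [add_sub_cancel] at h

theorem GradedRing.proj_mul_of_right_mem {i : ℤ} {b : A} (hb : b ∈ 𝒜 i) (n : ℤ) (a : A) :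
    GradedRing.proj 𝒜 n (a * b) = GradedRing.proj 𝒜 (n - i) a * b := by
  have h := DirectSum.coe_decompose_mul_add_of_right_mem 𝒜 (i := n - i) (a := a) hb
  rwa [sub_add_cancel] at h

theorem GradedRing.proj_of_mem {i : ℤ} {a : A} (ha : a ∈ 𝒜 i) : GradedRing.proj 𝒜 i a = a :=
  DirectSum.decompose_of_mem_same 𝒜 ha

theorem GradedRing.proj_of_mem_ne {i j : ℤ} {a : A} (ha : a ∈ 𝒜 i) (h : i ≠ j) :
    GradedRing.proj 𝒜 j a = 0 :=
  DirectSum.decompose_of_mem_ne 𝒜 ha h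

theorem GradedRing.exists_finset_sum_proj (𝒜 : ℤ → AddSubgroup A) [GradedRing 𝒜] (a : A) :
    ∃ s : Finset ℤ, (∀ i, GradedRing.proj 𝒜 i a ≠ 0 → i ∈ s) ∧
      ∑ i ∈ s, GradedRing.proj 𝒜 i a = a := by
  classical
  exact ⟨(DirectSum.decompose 𝒜 a).support, fun i hi => (GradedRing.mem_support_iff 𝒜 a i).2 hi,
    DirectSum.sum_support_decompose 𝒜 a⟩

/-- An element cannot have nonzero components along a whole arithmetic progression of degrees. -/
theorem GradedRing.exists_proj_eq_zero (a : A) {j : ℤ} (hj : j ≠ 0) (m : ℤ) :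
    ∃ k : ℕ, GradedRing.proj 𝒜 (m + k * j) a = 0 := by
  obtain ⟨s, hs, -⟩ := GradedRing.exists_finset_sum_proj 𝒜 a
  by_contra! h
  have hinj : Function.Injective fun k : ℕ => m + k * j := fun k l hkl => by
    simpa [hj] using hkl
  exact (Set.infinite_of_injective_forall_mem hinj fun k => hs _ (h k)) s.finite_toSet

theorem mul_mem_gradedCorner {i j n : ℤ} {x y : A} (hx : x ∈ gradedCorner 𝒜 e i)
    (hy : y ∈ gradedCorner 𝒜 e j) (h : i + j = n) : x * y ∈ gradedCorner 𝒜 e n := by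
  subst h
  exact ⟨SetLike.mul_mem_graded hx.1 hy.1, by rw [← mul_assoc, hx.2.1],
    by rw [mul_assoc, hy.2.2]⟩

theorem proj_mem_gradedCorner (he : e ∈ 𝒜 0) {a : A} (hea : e * a = a) (hae : a * e = a)
    (i : ℤ) : GradedRing.proj 𝒜 i a ∈ gradedCorner 𝒜 e i := by
  refine ⟨GradedRing.proj_mem i a, ?_, ?_⟩
  · simpa [hea] using (GradedRing.proj_mul_of_left_mem he i a).symm
  · simpa [hae] using (GradedRing.proj_mul_of_right_mem he i a).symm

theorem mul_proj_mul_mem_gradedCorner (he : e ∈ 𝒜 0) (hi : IsIdempotentElem e) (i : ℤ) (a : A) :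
    e * GradedRing.proj 𝒜 i a * e ∈ gradedCorner 𝒜 e i := by
  refine ⟨?_, by simp only [← mul_assoc, hi.eq], by rw [mul_assoc, hi.eq]⟩
  simpa using SetLike.mul_mem_graded (SetLike.mul_mem_graded he (GradedRing.proj_mem i a)) he

theorem pow_mem_gradedCorner {x : A} (hx : x ∈ gradedCorner 𝒜 e 0) (k : ℕ) :
    x ^ (k + 1) ∈ gradedCorner 𝒜 e 0 := by
  induction k with
  | zero => simpa using hx
  | succ k ih => rw [pow_succ]; exact mul_mem_gradedCorner ih hx (add_zero 0)

namespace IsGradedPrimitiveIdempotent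

theorem isNilpotent_or_exists_mul_eq [IsArtinian A A] (he : IsGradedPrimitiveIdempotent 𝒜 e)
    {x : A} (hx : x ∈ gradedCorner 𝒜 e 0) :
    IsNilpotent x ∨ ∃ u ∈ gradedCorner 𝒜 e 0, u * x = e := by
  have : IsArtinianRing A := ‹_›
  have : IsNoetherian A A := inferInstanceAs (IsNoetherianRing A)
  let r : Module.End A A := LinearMap.toSpanSingleton A A x
  have hr : ∀ (k : ℕ) (a : A), (r ^ k) a = a * x ^ k := by
    intro k
    induction k with
    | zero => simp
    | succ k ih =>
      intro a
      rw [pow_succ', Module.End.mul_apply, ih]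
      simp [r, pow_succ, mul_assoc]
  obtain ⟨N, hN⟩ := Filter.eventually_atTop.1 (LinearMap.eventually_isCompl_ker_pow_range_pow r)
  have hc := hN (N + 1) N.le_succ
  set z := x ^ (N + 1) with hz
  have hzC : z ∈ gradedCorner 𝒜 e 0 := pow_mem_gradedCorner hx N
  have hdisj : ∀ a b : A, a * z = 0 → a = b * z → a = 0 := fun a b ha hb =>
    (Submodule.disjoint_def.1 hc.disjoint) a (by simpa [hr] using ha)
      ⟨b, by rw [hr]; exact hb.symm⟩
  obtain ⟨u', hu', v', ⟨b', hb'⟩, huv'⟩ := Submodule.mem_sup.1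
    (hc.sup_eq_top ▸ Submodule.mem_top : e ∈ LinearMap.ker (r ^ (N + 1)) ⊔ LinearMap.range _)
  rw [LinearMap.mem_ker, hr] at hu'
  rw [hr] at hb'
  obtain ⟨b, hb, u, hu, huz, huv⟩ : ∃ b ∈ gradedCorner 𝒜 e 0, ∃ u ∈ gradedCorner 𝒜 e 0,
      u * z = 0 ∧ u + b * z = e := by
    refine ⟨_, mul_proj_mul_mem_gradedCorner he.mem he.idem 0 b',
      _, mul_proj_mul_mem_gradedCorner he.mem he.idem 0 u', ?_, ?_⟩
    · have := GradedRing.proj_mul_of_right_mem hzC.1 0 u'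
      rw [hu', map_zero, sub_zero] at this
      rw [mul_assoc, hzC.2.1, mul_assoc, ← this, mul_zero]
    · have := GradedRing.proj_mul_of_right_mem hzC.1 0 b'
      rw [sub_zero] at this
      have h0 : GradedRing.proj 𝒜 0 u' + GradedRing.proj 𝒜 0 (b' * z) = e := by
        rw [← map_add, hb', huv', GradedRing.proj_of_mem he.mem]
      rw [this] at h0
      calc _ = e * (GradedRing.proj 𝒜 0 u' + GradedRing.proj 𝒜 0 b' * z) * e := by
            rw [mul_assoc _ e z, hzC.2.1, mul_add, add_mul]
            congr 1
            rw [mul_assoc e (_ * z), mul_assoc _ z, hzC.2.2, mul_assoc]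
        _ = e := by rw [h0, he.idem.eq, he.idem.eq]
  have hvC := mul_mem_gradedCorner hb hzC (add_zero 0)
  have huvz : u * (b * z) = 0 := by
    refine hdisj _ (u * b) ?_ (by rw [mul_assoc])
    have : u * (b * z) = u - u * u := by
      rw [eq_sub_iff_add_eq', ← mul_add, huv, hu.2.2]
    rw [this, sub_mul, huz, mul_assoc, huz, mul_zero, sub_zero]
  have hvu : b * z * u = 0 := by
    refine hdisj _ (b - b * z * b) (by rw [mul_assoc, huz, mul_zero]) ?_
    have : b * z * u = b * z - b * z * (b * z) := by
      rw [eq_sub_iff_add_eq, ← mul_add, huv, hvC.2.2]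
    rw [this, sub_mul, ← mul_assoc (b * z)]
  have huu : IsIdempotentElem u := by
    have : u * (u + b * z) = u := by rw [huv, hu.2.2]
    rwa [mul_add, huvz, add_zero] at this
  have hvv : IsIdempotentElem (b * z) := by
    have : b * z * (u + b * z) = b * z := by rw [huv, hvC.2.2]
    rwa [mul_add, hvu, zero_add] at this
  rcases he.eq_zero_or u hu.1 _ hvC.1 huu hvv huvz hvu huv.symm with h | h
  · right
    rw [h, zero_add, hz] at huv
    rcases N with - | N
    · exact ⟨b, hb, by simpa using huv⟩
    · exact ⟨_, mul_mem_gradedCorner hb (pow_mem_gradedCorner hx N) (add_zero 0),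
        by rw [mul_assoc, ← pow_succ, huv]⟩
  · left
    rw [h, add_zero] at huv
    exact ⟨N + 1, by rw [← hz, ← hzC.2.1, ← huv, huz]⟩

theorem isNilpotent_mul_of_forall_mul_ne [IsArtinian A A]
    (he : IsGradedPrimitiveIdempotent 𝒜 e) {b x : A}
    (hx : x ∈ gradedCorner 𝒜 e 0) (hb : b ∈ gradedCorner 𝒜 e 0)
    (h : ∀ u ∈ gradedCorner 𝒜 e 0, u * x ≠ e) : IsNilpotent (b * x) :=
  (he.isNilpotent_or_exists_mul_eq (mul_mem_gradedCorner hb hx (add_zero 0))).resolve_right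
    fun ⟨u, hu, hux⟩ => h _ (mul_mem_gradedCorner hu hb (add_zero 0)) (by rw [mul_assoc, hux])

theorem forall_mul_add_ne [IsArtinian A A] (he : IsGradedPrimitiveIdempotent 𝒜 e) {x y : A}
    (hx : x ∈ gradedCorner 𝒜 e 0) (hy : y ∈ gradedCorner 𝒜 e 0)
    (hxu : ∀ u ∈ gradedCorner 𝒜 e 0, u * x ≠ e) (hyu : ∀ u ∈ gradedCorner 𝒜 e 0, u * y ≠ e) :
    ∀ u ∈ gradedCorner 𝒜 e 0, u * (x + y) ≠ e := by
  intro w hw hwe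
  have hn := he.isNilpotent_mul_of_forall_mul_ne hx hw hxu
  obtain ⟨v, hv⟩ := hn.isUnit_one_sub.exists_left_inv
  have hwx := mul_mem_gradedCorner hw hx (add_zero 0)
  have hwy : w * y = (1 - w * x) * e := by
    rw [sub_mul, one_mul, hwx.2.2, ← hwe, mul_add, add_sub_cancel_left]
  have hvy : v * (w * y) = e := by rw [hwy, ← mul_assoc, hv, one_mul]
  have hwyC := mul_mem_gradedCorner hw hy (add_zero 0)
  refine hyu _ (mul_mem_gradedCorner
    (mul_proj_mul_mem_gradedCorner he.mem he.idem 0 v) hw (add_zero 0)) ?_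
  have := GradedRing.proj_mul_of_right_mem hwyC.1 0 v
  rw [hvy, GradedRing.proj_of_mem he.mem, sub_zero] at this
  rw [mul_assoc, mul_assoc, hwyC.2.1, mul_assoc, ← this, he.idem.eq]

theorem forall_mul_sum_ne [IsArtinian A A] (he : IsGradedPrimitiveIdempotent 𝒜 e) {ι : Type*}
    (s : Finset ι) (c : ι → A) (hc : ∀ i ∈ s, c i ∈ gradedCorner 𝒜 e 0)
    (hcu : ∀ i ∈ s, ∀ u ∈ gradedCorner 𝒜 e 0, u * c i ≠ e) :
    ∀ u ∈ gradedCorner 𝒜 e 0, u * ∑ i ∈ s, c i ≠ e := by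
  classical
  induction s using Finset.induction_on with
  | empty => intro u _; simpa using he.ne_zero.symm
  | insert i s hi ih =>
    rw [Finset.sum_insert hi]
    rw [Finset.forall_mem_insert] at hc hcu
    exact he.forall_mul_add_ne hc.1 (sum_mem hc.2) hcu.1 (ih hc.2 hcu.2)

/-- The corner has no left invertible element in nonzero degree. -/
theorem mul_ne_of_degree_ne_zero [IsArtinian A A] (he : IsGradedPrimitiveIdempotent 𝒜 e)
    {j : ℤ} (hj : j ≠ 0) {x b : A} (hb : b ∈ gradedCorner 𝒜 e j) : b * x ≠ e := by
  intro hbx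
  have hcancel : ∀ a : A, a * e ≠ 0 → a * b ≠ 0 := fun a ha hab => ha <| by
    rw [← hbx, ← mul_assoc, hab, zero_mul]
  let r : A →ₗ[A] A := LinearMap.toSpanSingleton A A (1 + b)
  have hcomp : ∀ a n, GradedRing.proj 𝒜 n (r a) =
      GradedRing.proj 𝒜 n a + GradedRing.proj 𝒜 (n - j) a * b := fun a n => by
    rw [← GradedRing.proj_mul_of_right_mem hb.1, ← map_add]
    simp [r, mul_add]
  have hinj : Function.Injective r := by
    refine (injective_iff_map_eq_zero r).2 fun a ha => ?_
    have hab : a + a * b = 0 := by simpa [r, mul_add] using ha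
    have hae : a * e = a := by
      rw [eq_neg_of_add_eq_zero_left hab, neg_mul, mul_assoc, hb.2.2]
    by_contra hne
    obtain ⟨n, hn⟩ : ∃ n, GradedRing.proj 𝒜 n a ≠ 0 := by
      by_contra! h
      obtain ⟨s, -, hs⟩ := GradedRing.exists_finset_sum_proj 𝒜 a
      exact hne (by rw [← hs]; exact Finset.sum_eq_zero fun i _ => h i)
    obtain ⟨k, hk⟩ := GradedRing.exists_proj_eq_zero (𝒜 := 𝒜) a hj n
    refine (?_ : ∀ k : ℕ, GradedRing.proj 𝒜 (n + k * j) a ≠ 0) k hk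
    intro k
    induction k with
    | zero => simpa using hn
    | succ k ih =>
      have h := hcomp a (n + (k + 1 : ℕ) * j)
      rw [ha, map_zero, show n + ((k + 1 : ℕ) : ℤ) * j - j = n + k * j by push_cast; ring] at h
      rw [eq_neg_of_add_eq_zero_left h.symm, neg_ne_zero]
      refine hcancel _ ?_
      have := GradedRing.proj_mul_of_right_mem he.mem (n + k * j) a
      rw [hae, sub_zero] at this
      rwa [← this]
  obtain ⟨a, ha⟩ := (IsArtinian.bijective_of_injective_endomorphism r hinj).2 1
  have hone : (1 : A) ∈ 𝒜 0 := SetLike.GradedOne.one_mem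
  have hrec : ∀ n, n ≠ 0 → GradedRing.proj 𝒜 n a = -(GradedRing.proj 𝒜 (n - j) a * b) := by
    intro n hn
    rw [← add_eq_zero_iff_eq_neg, ← hcomp, ha, GradedRing.proj_of_mem_ne hone hn.symm]
  have hforward : GradedRing.proj 𝒜 0 a * e = 0 := by
    by_contra hne
    obtain ⟨k, hk⟩ := GradedRing.exists_proj_eq_zero (𝒜 := 𝒜) a hj 0
    refine (?_ : ∀ k : ℕ, GradedRing.proj 𝒜 (0 + k * j) a * e ≠ 0) k (by rw [hk, zero_mul])
    intro k
    induction k with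
    | zero => simpa using hne
    | succ k ih =>
      rw [hrec _ (by rw [zero_add]; exact mul_ne_zero (by positivity) hj),
        show 0 + ((k + 1 : ℕ) : ℤ) * j - j = 0 + k * j by push_cast; ring, neg_mul, mul_assoc,
        hb.2.2, neg_ne_zero]
      exact hcancel _ ih
  obtain ⟨k, hk⟩ := GradedRing.exists_proj_eq_zero (𝒜 := 𝒜) a (neg_ne_zero.2 hj) (-j)
  refine (?_ : ∀ k : ℕ, GradedRing.proj 𝒜 (-j + k * -j) a * b ≠ 0) k (by rw [hk, zero_mul])
  intro k
  induction k with
  | zero =>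
    intro h0
    have h := hcomp a 0
    rw [ha, GradedRing.proj_of_mem hone] at h
    have h0' : GradedRing.proj 𝒜 (0 - j) a * b = 0 := by simpa using h0
    rw [h0', add_zero] at h
    rw [← h, one_mul] at hforward
    exact he.ne_zero hforward
  | succ k ih =>
    intro h0
    refine ih ?_
    rw [hrec (-j + k * -j) (by
        rw [show -j + (k : ℤ) * -j = (k + 1 : ℤ) * -j by ring]
        exact mul_ne_zero (by positivity) (neg_ne_zero.2 hj)),
      show -j + (k : ℤ) * -j - j = -j + ((k + 1 : ℕ) : ℤ) * -j by push_cast; ring, h0,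
      neg_zero, zero_mul]

theorem isNilpotent_mul_of_degree_ne_zero [IsArtinian A A]
    (he : IsGradedPrimitiveIdempotent 𝒜 e) {i : ℤ} (hi : i ≠ 0) {x b : A}
    (hx : x ∈ gradedCorner 𝒜 e i) (hb : b ∈ gradedCorner 𝒜 e (-i)) : IsNilpotent (b * x) :=
  (he.isNilpotent_or_exists_mul_eq (mul_mem_gradedCorner hb hx (neg_add_cancel i))).resolve_right
    fun ⟨_, hu, hux⟩ => he.mul_ne_of_degree_ne_zero (neg_ne_zero.2 hi)
      (mul_mem_gradedCorner hu hb (zero_add _)) (by rw [mul_assoc, hux])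

/-- An idempotent of the corner whose components generate nilpotents in degree `0` vanishes. -/
theorem eq_zero_of_forall_isNilpotent [IsArtinian A A] (he : IsGradedPrimitiveIdempotent 𝒜 e)
    {f : A} (hf : IsIdempotentElem f) (hef : e * f = f) (hfe : f * e = f)
    (hnil : ∀ i, ∀ b ∈ gradedCorner 𝒜 e (-i), IsNilpotent (b * GradedRing.proj 𝒜 i f)) :
    f = 0 := by
  by_contra hne
  obtain ⟨_, ⟨j, y, hy, hey, hfy, rfl⟩, hmin⟩ := IsArtinian.set_has_minimal
    {L : Submodule A A | ∃ j, ∃ y ∈ 𝒜 j, e * y = y ∧ f * y ≠ 0 ∧ L = Submodule.span A {y}}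
    ⟨_, 0, e, he.mem, he.idem, by rwa [hfe], rfl⟩
  obtain ⟨s, -, hs⟩ := GradedRing.exists_finset_sum_proj 𝒜 f
  obtain ⟨i, -, hi⟩ : ∃ i ∈ s, f * (GradedRing.proj 𝒜 i f * y) ≠ 0 := by
    refine Finset.exists_ne_zero_of_sum_ne_zero ?_
    rwa [← Finset.mul_sum, ← Finset.sum_mul, hs, ← mul_assoc, hf.eq]
  have hfi := proj_mem_gradedCorner he.mem hef hfe i
  set g := GradedRing.proj 𝒜 i f
  have hle : Submodule.span A {g * y} ≤ Submodule.span A {y} :=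
    (Submodule.span_singleton_le_iff_mem _ _).2 (Submodule.mem_span_singleton.2 ⟨g, rfl⟩)
  have hnot := hmin _ ⟨i + j, g * y, SetLike.mul_mem_graded hfi.1 hy,
    by rw [← mul_assoc, hfi.2.1], hi, rfl⟩
  have hmem : y ∈ Submodule.span A {g * y} := by
    rw [hle.eq_of_not_lt hnot]
    exact Submodule.mem_span_singleton_self y
  obtain ⟨b, hb⟩ := Submodule.mem_span_singleton.1 hmem
  rw [smul_eq_mul] at hb
  have hcy : e * GradedRing.proj 𝒜 (-i) b * e * g * y = y := by
    have := GradedRing.proj_mul_of_right_mem (SetLike.mul_mem_graded hfi.1 hy) j b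
    rw [hb, GradedRing.proj_of_mem hy, show j - (i + j) = -i by ring] at this
    rw [mul_assoc _ e g, hfi.2.1, mul_assoc, mul_assoc, ← this, hey]
  obtain ⟨k, hk⟩ := hnil i _ (mul_proj_mul_mem_gradedCorner he.mem he.idem (-i) b)
  have hpow : ∀ k : ℕ, (e * GradedRing.proj 𝒜 (-i) b * e * g) ^ k * y = y := by
    intro k
    induction k with
    | zero => simp
    | succ k ih => rw [pow_succ, mul_assoc, hcy, ih]
  refine hfy ?_
  rw [← hpow k, hk, zero_mul, mul_zero]

theorem eq_zero_of_forall_mul_ne [IsArtinian A A] (he : IsGradedPrimitiveIdempotent 𝒜 e)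
    {f : A} (hf : IsIdempotentElem f) (hef : e * f = f) (hfe : f * e = f)
    (h : ∀ u ∈ gradedCorner 𝒜 e 0, u * GradedRing.proj 𝒜 0 f ≠ e) : f = 0 := by
  refine he.eq_zero_of_forall_isNilpotent hf hef hfe fun i b hb => ?_
  have hfi := proj_mem_gradedCorner he.mem hef hfe i
  rcases eq_or_ne i 0 with rfl | hi
  · exact he.isNilpotent_mul_of_forall_mul_ne hfi (by simpa using hb) h
  · exact he.isNilpotent_mul_of_degree_ne_zero hi hfi hb

/-- In a left artinian graded ring, a degree `0` idempotent that is primitive among degree `0`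
idempotents is primitive. -/
theorem isPrimitiveIdempotent [IsArtinian A A] (he : IsGradedPrimitiveIdempotent 𝒜 e) :
    IsPrimitiveIdempotent e := by
  refine ⟨he.idem, he.ne_zero, fun a b ha hb hab hba heab => ?_⟩
  have hea : e * a = a := by rw [heab, add_mul, ha.eq, hba, add_zero]
  have hae : a * e = a := by rw [heab, mul_add, ha.eq, hab, add_zero]
  have heb : e * b = b := by rw [heab, add_mul, hb.eq, hab, zero_add]
  have hbe : b * e = b := by rw [heab, mul_add, hb.eq, hba, zero_add]
  by_cases hua : ∀ u ∈ gradedCorner 𝒜 e 0, u * GradedRing.proj 𝒜 0 a ≠ e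
  · exact Or.inl (he.eq_zero_of_forall_mul_ne ha hea hae hua)
  by_cases hub : ∀ u ∈ gradedCorner 𝒜 e 0, u * GradedRing.proj 𝒜 0 b ≠ e
  · exact Or.inr (he.eq_zero_of_forall_mul_ne hb heb hbe hub)
  exfalso
  push Not at hua hub
  obtain ⟨u, hu, hua⟩ := hua
  obtain ⟨w, hw, hwb⟩ := hub
  have haC := proj_mem_gradedCorner he.mem hea hae
  have hbC := proj_mem_gradedCorner he.mem heb hbe
  obtain ⟨s, hs, hsum⟩ := GradedRing.exists_finset_sum_proj 𝒜 a
  have h0 : (0 : ℤ) ∈ s := hs 0 fun h => he.ne_zero (by rw [← hua, h, mul_zero])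
  have hzero : ∑ i ∈ s, GradedRing.proj 𝒜 i a * GradedRing.proj 𝒜 (-i) b = 0 := by
    rw [← map_zero (GradedRing.proj 𝒜 0), ← hab]
    conv_rhs => rw [← hsum, Finset.sum_mul, map_sum]
    refine Finset.sum_congr rfl fun i _ => ?_
    rw [GradedRing.proj_mul_of_left_mem (GradedRing.proj_mem i a), zero_sub]
  rw [← Finset.add_sum_erase s _ h0, neg_zero] at hzero
  have hwu := mul_mem_gradedCorner hw hu (add_zero 0)
  refine he.forall_mul_sum_ne (s.erase 0)
    (fun i => GradedRing.proj 𝒜 i a * GradedRing.proj 𝒜 (-i) b)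
    (fun i _ => mul_mem_gradedCorner (haC i) (hbC (-i)) (add_neg_cancel i))
    (fun i hi v hv => ?_) _ (neg_mem hwu) ?_
  · rw [← mul_assoc]
    exact he.mul_ne_of_degree_ne_zero (Finset.ne_of_mem_erase hi)
      (mul_mem_gradedCorner hv (haC i) (zero_add i))
  · rw [eq_neg_of_add_eq_zero_right hzero, neg_mul_neg, mul_assoc, ← mul_assoc u, hua,
      (hbC 0).2.1, hwb]

end IsGradedPrimitiveIdempotent

end GradedCorner

/-- **Homogeneous primitive idempotents.**  Let `A` be a left-artinian ring with a
`ℤ`-grading `𝒜` (no positivity assumption).  Then there exists a complete system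
of primitive pairwise orthogonal idempotents in `A` all of whose members are
homogeneous (necessarily of degree `0`). -/
theorem exists_complete_system_of_homogeneous_primitive_idempotents
    {A : Type*} [Ring A] [IsArtinian A A]
    (𝒜 : ℤ → AddSubgroup A) [GradedRing 𝒜] :
    ∃ (m : ℕ) (e : Fin m → A),
      (∀ x, IsPrimitiveIdempotent (e x)) ∧
      (∀ x y, x ≠ y → e x * e y = 0) ∧
      (∑ x, e x) = 1 ∧
      (∀ x, e x ∈ 𝒜 0) := by
  obtain ⟨ι, _, p, hp, horth, -, hsum⟩ := exists_sum_gradedPrimitiveIdempotent_eq (𝒜 := 𝒜) 1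
    SetLike.GradedOne.one_mem IsIdempotentElem.one
  refine ⟨Fintype.card ι, p ∘ (Fintype.equivFin ι).symm, fun x => (hp _).isPrimitiveIdempotent,
    fun x y h => horth _ _ fun h' => h ((Fintype.equivFin ι).symm.injective h'), ?_,
    fun x => (hp _).mem⟩
  rw [← hsum]
  exact (Fintype.equivFin ι).symm.sum_comp p
end

section
/- Let A be a ℤ-graded left-artinian ring. Then forgetting the grading induces a bijection between the set of isomorphism classes of simple ℤ-graded A-modules modulo grading shift and the set of isomorphism classes of simple ungraded A-modules. -/
universe u

/-- A bundled `ℤ`-graded module over a `ℤ`-graded ring `(A, 𝒜)`. -/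
structure GradedModuleOver (A : Type u) [Ring A] (𝒜 : ℤ → AddSubgroup A) :
    Type (u + 1) where
  carrier : Type u
  [isAddCommGroup : AddCommGroup carrier]
  [isModule : Module A carrier]
  grading : ℤ → AddSubgroup carrier
  [isDecomposition : DirectSum.Decomposition grading]
  smul_mem : ∀ ⦃i j : ℤ⦄ ⦃a : A⦄ ⦃m : carrier⦄,
    a ∈ 𝒜 i → m ∈ grading j → a • m ∈ grading (i + j)

attribute [instance] GradedModuleOver.isAddCommGroup GradedModuleOver.isModule
  GradedModuleOver.isDecomposition

/-- A bundled module over a ring `A`. -/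
structure ModuleOver (A : Type u) [Ring A] : Type (u + 1) where
  carrier : Type u
  [isAddCommGroup : AddCommGroup carrier]
  [isModule : Module A carrier]

attribute [instance] ModuleOver.isAddCommGroup ModuleOver.isModule

/-- A graded module is graded-simple if it is nonzero and its only graded
submodules (submodules stable under homogeneous components) are `⊥` and `⊤`. -/
def IsGradedSimple {A : Type u} [Ring A] {𝒜 : ℤ → AddSubgroup A}
    (M : GradedModuleOver A 𝒜) : Prop :=
  Nontrivial M.carrier ∧
    ∀ p : Submodule A M.carrier,
      (∀ (j : ℤ), ∀ x ∈ p, (DirectSum.decompose M.grading x j : M.carrier) ∈ p) →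
      p = ⊥ ∨ p = ⊤

/-- Isomorphism of graded modules up to a shift of the grading. -/
def ShiftIsoRel {A : Type u} [Ring A] {𝒜 : ℤ → AddSubgroup A}
    (M N : GradedModuleOver A 𝒜) : Prop :=
  ∃ (i : ℤ) (e : M.carrier ≃ₗ[A] N.carrier),
    ∀ (j : ℤ), ∀ x ∈ M.grading j, e x ∈ N.grading (i + j)

open DirectSum

section Decomposition

variable {M N : Type*} [AddCommGroup M] [AddCommGroup N]
  (ℳ : ℤ → AddSubgroup M) [Decomposition ℳ] (𝒩 : ℤ → AddSubgroup N) [Decomposition 𝒩]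

/-- An additive map which is homogeneous of degree `d` commutes with taking components. -/
theorem decompose_map_of_degree (f : M →+ N) (d : ℤ)
    (hf : ∀ j, ∀ x ∈ ℳ j, f x ∈ 𝒩 (d + j)) (x : M) (j : ℤ) :
    (decompose 𝒩 (f x) (d + j) : N) = f (decompose ℳ x j) := by
  induction x using Decomposition.inductionOn ℳ with
  | zero => simp
  | @homogeneous i m =>
    by_cases h : i = j
    · subst h
      rw [decompose_of_mem_same _ (hf _ _ m.2), decompose_of_mem_same _ m.2]
    · rw [decompose_of_mem_ne _ (hf _ _ m.2) (by lia), decompose_of_mem_ne _ m.2 h, map_zero]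
  | add m m' h h' => simp [h, h']

theorem finite_setOf_decompose_ne_zero (x : M) :
    {j | (decompose ℳ x j : M) ≠ 0}.Finite := by
  classical
  refine (decompose ℳ x).support.finite_toSet.subset fun j hj => ?_
  simpa using hj

theorem exists_decompose_ne_zero {x : M} (hx : x ≠ 0) : ∃ j, (decompose ℳ x j : M) ≠ 0 := by
  classical
  contrapose! hx
  rw [← sum_support_decompose ℳ x]
  exact Finset.sum_eq_zero fun j _ => hx j

theorem exists_decompose_progression_eq_zero (x : M) (n : ℤ) {d : ℤ} (hd : d ≠ 0) :
    ∃ k : ℕ, (decompose ℳ x (n + k * d) : M) = 0 := by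
  by_contra! h
  refine Set.infinite_range_of_injective (f := fun k : ℕ => n + k * d) (fun a b hab => ?_)
    ((finite_setOf_decompose_ne_zero ℳ x).subset ?_)
  · simpa [hd] using hab
  · rintro _ ⟨k, rfl⟩
    exact h k

/-- A nonzero artinian graded module has no injective endomorphism of nonzero degree. -/
theorem subsingleton_of_injective_of_degree_ne_zero {A : Type*} [Ring A] [Module A M]
    [IsArtinian A M] (φ : M →ₗ[A] M) (hinj : Function.Injective φ) {d : ℤ} (hd : d ≠ 0)
    (hφ : ∀ j, ∀ x ∈ ℳ j, φ x ∈ ℳ (d + j)) : Subsingleton M := by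
  have hcomp (x : M) (j : ℤ) : (decompose ℳ (φ x) (d + j) : M) = φ (decompose ℳ x j) :=
    decompose_map_of_degree ℳ ℳ φ.toAddMonoidHom d hφ x j
  have hφ0 {x : M} (hx : x ≠ 0) : φ x ≠ 0 := by rwa [Ne, map_eq_zero_iff φ hinj]
  have hg : Function.Injective (LinearMap.id - φ : M →ₗ[A] M) := by
    rw [injective_iff_map_eq_zero]
    intro x hx
    have hx' : φ x = x := (sub_eq_zero.mp hx).symm
    by_contra hne
    obtain ⟨n, hn⟩ := exists_decompose_ne_zero ℳ hne
    obtain ⟨k, hk⟩ := exists_decompose_progression_eq_zero ℳ x n hd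
    refine absurd hk ?_
    clear hk
    induction k with
    | zero => rwa [Nat.cast_zero, zero_mul, add_zero]
    | succ k ih =>
      have h := hcomp x (n + k * d)
      rw [hx'] at h
      rw [show n + ((k + 1 : ℕ) : ℤ) * d = d + (n + k * d) by push_cast; ring, h]
      exact hφ0 ih
  have hsurj := IsArtinian.surjective_of_injective_endomorphism _ hg
  by_contra hM
  rw [not_subsingleton_iff_nontrivial] at hM
  obtain ⟨y, hy⟩ := exists_ne (0 : M)
  obtain ⟨n, m, hm, hn⟩ : ∃ n, ∃ m ∈ ℳ n, m ≠ 0 :=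
    (exists_decompose_ne_zero ℳ hy).imp fun n hn => ⟨_, (decompose ℳ y n).2, hn⟩
  obtain ⟨x, hx⟩ := hsurj m
  have hx' : x = m + φ x := eq_add_of_sub_eq hx
  have hxc (j : ℤ) : (decompose ℳ x (d + j) : M) =
      decompose ℳ m (d + j) + φ (decompose ℳ x j) := by
    rw [← hcomp]
    nth_rewrite 1 [hx']
    simp
  have hd_mul (k : ℕ) : ((k : ℤ) + 1) * d ≠ 0 := mul_ne_zero (by lia) hd
  by_cases h0 : (decompose ℳ x n : M) = 0
  · obtain ⟨k, hk⟩ := exists_decompose_progression_eq_zero ℳ x (n - d) (neg_ne_zero.mpr hd)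
    refine absurd hk ?_
    clear hk
    induction k with
    | zero =>
      have h := hxc (n - d)
      rw [add_sub_cancel, h0, decompose_of_mem_same ℳ hm] at h
      intro hz
      rw [Nat.cast_zero, zero_mul, add_zero] at hz
      exact hn (by simpa [hz] using h.symm)
    | succ k ih =>
      have h := hxc (n - d + ((k + 1 : ℕ) : ℤ) * -d)
      intro hz
      rw [show d + (n - d + ((k + 1 : ℕ) : ℤ) * -d) = n - d + k * -d by push_cast; ring, hz,
        decompose_of_mem_ne ℳ hm (by have := hd_mul k; grind)] at h
      exact ih (by simpa using h)
  · obtain ⟨k, hk⟩ := exists_decompose_progression_eq_zero ℳ x n hd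
    refine absurd hk ?_
    clear hk
    induction k with
    | zero => rwa [Nat.cast_zero, zero_mul, add_zero]
    | succ k ih =>
      have h := hxc (n + k * d)
      rw [decompose_of_mem_ne ℳ hm (by have := hd_mul k; grind), zero_add] at h
      rw [show n + ((k + 1 : ℕ) : ℤ) * d = d + (n + k * d) by push_cast; ring, h]
      exact hφ0 ih

end Decomposition

section GradedSimple

variable {A : Type u} [Ring A] {𝒜 : ℤ → AddSubgroup A}

theorem GradedModuleOver.decompose_homogeneous_smul (M : GradedModuleOver A 𝒜) {a : A} {i : ℤ}
    (ha : a ∈ 𝒜 i) (x : M.carrier) (j : ℤ) :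
    (decompose M.grading (a • x) (i + j) : M.carrier) = a • (decompose M.grading x j : M.carrier) :=
  decompose_map_of_degree M.grading M.grading (DistribSMul.toAddMonoidHom M.carrier a) i
    (fun _ _ hx => M.smul_mem ha hx) x j

theorem IsGradedSimple.injective_of_degree {M : GradedModuleOver A 𝒜} (hM : IsGradedSimple M)
    (φ : M.carrier →ₗ[A] M.carrier) (hne : φ ≠ 0) {d : ℤ}
    (hφ : ∀ j, ∀ x ∈ M.grading j, φ x ∈ M.grading (d + j)) : Function.Injective φ := by
  have hcomp := decompose_map_of_degree M.grading M.grading φ.toAddMonoidHom d hφ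
  refine LinearMap.ker_eq_bot.mp ((hM.2 φ.ker fun j x hx => ?_).resolve_right
    fun h => hne (LinearMap.ker_eq_top.mp h))
  have h := hcomp x j
  simp only [LinearMap.toAddMonoidHom_coe, LinearMap.mem_ker.mp hx] at h
  simpa using h.symm

variable [GradedRing 𝒜]

theorem GradedModuleOver.decompose_smul_homogeneous (M : GradedModuleOver A 𝒜) {x : M.carrier}
    {i : ℤ} (hx : x ∈ M.grading i) (a : A) (j : ℤ) :
    (decompose M.grading (a • x) (i + j) : M.carrier) = (decompose 𝒜 a j : A) • x :=
  decompose_map_of_degree 𝒜 M.grading (LinearMap.toSpanSingleton A M.carrier x).toAddMonoidHom i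
    (fun j _ ha => add_comm j i ▸ M.smul_mem ha hx) a j

theorem IsGradedSimple.toSpanSingleton_surjective {M : GradedModuleOver A 𝒜}
    (hM : IsGradedSimple M) {x : M.carrier} {i : ℤ} (hx : x ∈ M.grading i) (hx0 : x ≠ 0) :
    Function.Surjective (LinearMap.toSpanSingleton A M.carrier x) := by
  refine LinearMap.range_eq_top.mp ((hM.2 _ ?_).resolve_left ?_)
  · rintro j _ ⟨a, rfl⟩
    obtain ⟨j, rfl⟩ : ∃ k, j = i + k := ⟨j - i, by ring⟩
    exact ⟨decompose 𝒜 a j, (M.decompose_smul_homogeneous hx a j).symm⟩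
  · intro h
    exact hx0 ((Submodule.mem_bot A).mp (h ▸ ⟨1, by simp⟩))

/-- If every element of `A` killing the homogeneous element `x` also kills the nonzero homogeneous
element `y` of a graded-simple artinian module, then `x` and `y` have the same degree. -/
theorem IsGradedSimple.degree_eq_of_annihilator_le [IsArtinian A A] {M : GradedModuleOver A 𝒜}
    (hM : IsGradedSimple M) {x y : M.carrier} {i j : ℤ} (hx : x ∈ M.grading i)
    (hy : y ∈ M.grading j) (hy0 : y ≠ 0) (h : ∀ a : A, a • x = 0 → a • y = 0) : i = j := by
  have hx0 : x ≠ 0 := fun hx0 => hy0 (by simpa using h 1 (by simpa using hx0))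
  have hsurj := hM.toSpanSingleton_surjective hx hx0
  have := isArtinian_of_surjective A _ hsurj
  let φ : M.carrier →ₗ[A] M.carrier :=
    ((LinearMap.toSpanSingleton A M.carrier x).ker.liftQ
      (LinearMap.toSpanSingleton A M.carrier y) h) ∘ₗ
      ((LinearMap.toSpanSingleton A M.carrier x).quotKerEquivOfSurjective hsurj).symm.toLinearMap
  have hφ (a : A) : φ (a • x) = a • y := by
    have : ((LinearMap.toSpanSingleton A M.carrier x).quotKerEquivOfSurjective hsurj).symm (a • x)
        = Submodule.Quotient.mk a := by
      rw [LinearEquiv.symm_apply_eq]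
      rfl
    simp only [φ, LinearMap.comp_apply, LinearEquiv.coe_coe, this]
    rfl
  have hφ0 : φ ≠ 0 := fun h0 => hy0 (by simpa [h0] using (hφ 1).symm)
  have hdeg : ∀ k, ∀ z ∈ M.grading k, φ z ∈ M.grading ((j - i) + k) := by
    intro k z hz
    obtain ⟨a, rfl⟩ := hsurj z
    have hz' := M.decompose_smul_homogeneous hx a (k - i)
    rw [LinearMap.toSpanSingleton_apply] at hz ⊢
    rw [add_sub_cancel, decompose_of_mem_same _ hz] at hz'
    rw [hz', hφ, show j - i + k = k - i + j by ring]
    exact M.smul_mem (decompose 𝒜 a (k - i)).2 hy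
  by_contra hij
  have := hM.1
  exact not_subsingleton M.carrier (subsingleton_of_injective_of_degree_ne_zero M.grading φ
    (hM.injective_of_degree φ hφ0 hdeg) (sub_ne_zero.mpr (Ne.symm hij)) hdeg)

/-- A graded-simple module over a graded left-artinian ring is simple. -/
theorem IsGradedSimple.isSimpleModule [IsArtinian A A] {M : GradedModuleOver A 𝒜}
    (hM : IsGradedSimple M) : IsSimpleModule A M.carrier := by
  have := hM.1
  refine (isSimpleModule_iff A M.carrier).mpr { eq_bot_or_eq_top := fun N => ?_ }
  refine or_iff_not_imp_left.mpr fun hN => ?_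
  let T (x : M.carrier) : Set ℤ := {j | (decompose M.grading x j : M.carrier) ≠ 0}
  have hT (x) : (T x).Finite := finite_setOf_decompose_ne_zero M.grading x
  obtain ⟨x, ⟨hxN, hx0⟩, hmin⟩ := (measure fun x => (T x).ncard).wf.has_min
    {x | x ∈ N ∧ x ≠ 0} (N.ne_bot_iff.mp hN)
  have hsmul {a : A} {k i : ℤ} (ha : a ∈ 𝒜 k) (hi : i ∈ T x)
      (hai : a • (decompose M.grading x i : M.carrier) = 0) : a • x = 0 := by
    by_contra hne
    refine hmin (a • x) ⟨N.smul_mem a hxN, hne⟩ ?_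
    have hsub : T (a • x) ⊆ (k + ·) '' (T x \ {i}) := by
      intro j hj
      refine ⟨j - k, ⟨fun h => ?_, ?_⟩, by simp⟩
      · refine hj ?_
        rw [← add_sub_cancel k j, M.decompose_homogeneous_smul ha, h, smul_zero]
      · rintro rfl
        refine hj ?_
        rw [← add_sub_cancel k j, M.decompose_homogeneous_smul ha, hai]
    calc (T (a • x)).ncard ≤ ((k + ·) '' (T x \ {i})).ncard :=
          Set.ncard_le_ncard hsub (((hT x).sdiff).image _)
      _ ≤ (T x \ {i}).ncard := Set.ncard_image_le (hT x).sdiff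
      _ < (T x).ncard := Set.ncard_sdiff_singleton_lt_of_mem hi (hT x)
  have hdeg {i j : ℤ} (hi : i ∈ T x) (hj : j ∈ T x) : i = j := by
    refine hM.degree_eq_of_annihilator_le (decompose M.grading x i).2 (decompose M.grading x j).2
      hj fun a ha => ?_
    classical
    rw [← sum_support_decompose 𝒜 a, Finset.sum_smul]
    refine Finset.sum_eq_zero fun k _ => ?_
    have hk := M.decompose_smul_homogeneous (decompose M.grading x i).2 a k
    rw [ha, decompose_zero] at hk
    have hkx := hsmul (decompose 𝒜 a k).2 hi (by simpa using hk.symm)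
    rw [← M.decompose_homogeneous_smul (decompose 𝒜 a k).2, hkx]
    simp
  obtain ⟨i, hi⟩ := exists_decompose_ne_zero M.grading hx0
  have hxi : x ∈ M.grading i := by
    classical
    rw [← sum_support_decompose M.grading x]
    refine sum_mem fun j hj => ?_
    rw [hdeg hi (j := j) (by simpa [T] using hj)]
    exact (decompose M.grading x j).2
  rw [eq_top_iff]
  intro y _
  obtain ⟨a, rfl⟩ := hM.toSpanSingleton_surjective hxi hx0 y
  exact N.smul_mem a hxN

/-- The component of degree `d` of a linear map between graded modules. -/
theorem GradedModuleOver.exists_linearMap_component {M N : GradedModuleOver A 𝒜}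
    (f : M.carrier →ₗ[A] N.carrier) (d : ℤ) :
    ∃ g : M.carrier →ₗ[A] N.carrier, ∀ j, ∀ x ∈ M.grading j,
      g x = decompose N.grading (f x) (d + j) := by
  let g : M.carrier →+ N.carrier := (DirectSum.toAddMonoid fun j =>
    (AddMonoidHom.mk' (fun y => (decompose N.grading y (d + j) : N.carrier)) (by simp)).comp
      (f.toAddMonoidHom.comp (M.grading j).subtype)).comp
    (decomposeAddEquiv M.grading).toAddMonoidHom
  have hg : ∀ j, ∀ x ∈ M.grading j, g x = decompose N.grading (f x) (d + j) := by
    intro j x hx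
    simp [g, decompose_of_mem _ hx]
  refine ⟨{ g with map_smul' := fun a x => ?_ }, hg⟩
  change g (a • x) = a • g x
  induction a using Decomposition.inductionOn 𝒜 with
  | zero => simp
  | add a b ha hb => simp [add_smul, ha, hb]
  | @homogeneous i a =>
    induction x using Decomposition.inductionOn M.grading with
    | zero => simp
    | add x y hx hy => simp [hx, hy]
    | @homogeneous j x =>
      rw [hg _ _ (M.smul_mem a.2 x.2), hg _ _ x.2, map_smul,
        ← N.decompose_homogeneous_smul a.2, add_left_comm]

/-- Two gradings on a simple module agree up to shift. -/
theorem ShiftIsoRel.of_linearEquiv {M N : GradedModuleOver A 𝒜} [IsSimpleModule A M.carrier]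
    [IsSimpleModule A N.carrier] (e : M.carrier ≃ₗ[A] N.carrier) : ShiftIsoRel M N := by
  have := IsSimpleModule.nontrivial A M.carrier
  obtain ⟨y, hy⟩ := exists_ne (0 : M.carrier)
  obtain ⟨j, hj⟩ := exists_decompose_ne_zero M.grading hy
  obtain ⟨k, hk⟩ := exists_decompose_ne_zero N.grading ((map_ne_zero_iff e e.injective).mpr hj)
  obtain ⟨g, hg⟩ := GradedModuleOver.exists_linearMap_component e.toLinearMap (k - j)
  have hg0 : g ≠ 0 := by
    rintro rfl
    have h := hg j _ (decompose M.grading y j).2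
    rw [sub_add_cancel] at h
    exact hk h.symm
  refine ⟨k - j, LinearEquiv.ofBijective g (LinearMap.bijective_of_ne_zero hg0), fun i x hx => ?_⟩
  rw [LinearEquiv.ofBijective_apply, hg i x hx]
  exact (decompose N.grading _ _).2


section Subquotient

variable {I K : Ideal A}

/-- The grading on the subquotient `I / (I ⊓ K)` of `A`. -/
def subquotientGrading (𝒜 : ℤ → AddSubgroup A) (I K : Ideal A) (j : ℤ) :
    AddSubgroup (I ⧸ K.submoduleOf I) :=
  ((𝒜 j).comap I.subtype.toAddMonoidHom).map (K.submoduleOf I).mkQ.toAddMonoidHom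

theorem mk_eq_sum_decompose (hI : I.IsHomogeneous 𝒜) [∀ i (x : 𝒜 i), Decidable (x ≠ 0)]
    (a : I) : (K.submoduleOf I).mkQ a =
      ∑ j ∈ (decompose 𝒜 (a : A)).support, (K.submoduleOf I).mkQ ⟨_, hI j a.2⟩ := by
  rw [← map_sum]
  congr 1
  ext
  simp [sum_support_decompose]

theorem mk_decompose_mem (hI : I.IsHomogeneous 𝒜) (a : I) (j : ℤ) :
    (K.submoduleOf I).mkQ ⟨_, hI j a.2⟩ ∈ subquotientGrading 𝒜 I K j :=
  ⟨_, (decompose 𝒜 (a : A) j).2, rfl⟩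

theorem decompose_subquotientGrading_mk [Decomposition (subquotientGrading 𝒜 I K)]
    (hI : I.IsHomogeneous 𝒜) (a : I) (j : ℤ) :
    (decompose (subquotientGrading 𝒜 I K) ((K.submoduleOf I).mkQ a) j : I ⧸ K.submoduleOf I) =
      (K.submoduleOf I).mkQ ⟨_, hI j a.2⟩ := by
  classical
  rw [mk_eq_sum_decompose hI a, decompose_sum, DFinsupp.finsetSum_apply, AddSubgroup.val_finsetSum,
    Finset.sum_eq_single j
      (fun i _ hi => decompose_of_mem_ne _ (mk_decompose_mem hI a i) hi) fun hj => ?_,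
    decompose_of_mem_same _ (mk_decompose_mem hI a j)]
  have h0 : (⟨_, hI j a.2⟩ : I) = 0 := by
    ext
    simpa using hj
  rw [h0]
  simp

theorem subquotientGrading_isInternal (hI : I.IsHomogeneous 𝒜) (hK : K.IsHomogeneous 𝒜) :
    IsInternal (subquotientGrading 𝒜 I K) := by
  classical
  constructor
  · rw [injective_iff_map_eq_zero]
    intro x hx
    have hex (j : ℤ) : ∃ r : I, (r : A) ∈ 𝒜 j ∧ (K.submoduleOf I).mkQ r = x j := (x j).2
    choose r hr hrx using hex
    have hsum : (K.submoduleOf I).mkQ (∑ j ∈ x.support, r j) = 0 := by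
      rw [map_sum, ← hx, coeAddMonoidHom_eq_dfinsuppSum]
      exact Finset.sum_congr rfl fun j _ => hrx j
    replace hsum : ∑ j ∈ x.support, (r j : A) ∈ K := by
      have h := (Submodule.Quotient.mk_eq_zero _).mp hsum
      simpa [Submodule.submoduleOf] using h
    ext i
    by_contra hi
    have hisupp : i ∈ x.support := by
      rw [DFinsupp.mem_support_iff]
      rintro h
      exact hi (by simp [h])
    have h := hK i hsum
    rw [decompose_sum, DFinsupp.finsetSum_apply, AddSubgroup.val_finsetSum,
      Finset.sum_eq_single_of_mem i hisupp
        fun j _ hj => decompose_of_mem_ne 𝒜 (hr j) hj, decompose_of_mem_same 𝒜 (hr i)] at h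
    refine hi ?_
    rw [← hrx i]
    exact (Submodule.Quotient.mk_eq_zero _).mpr h
  · intro y
    obtain ⟨a, rfl⟩ := (K.submoduleOf I).mkQ_surjective y
    rw [mk_eq_sum_decompose hI a]
    refine AddMonoidHom.mem_range.mp (sum_mem fun j _ => ?_)
    exact ⟨of _ j ⟨_, mk_decompose_mem hI a j⟩, coeAddMonoidHom_of _ _ _⟩

/-- The subquotient `I / (I ⊓ K)` of `A` attached to homogeneous left ideals `I` and `K`. -/
noncomputable abbrev gradedSubquotient (hI : I.IsHomogeneous 𝒜) (hK : K.IsHomogeneous 𝒜) :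
    GradedModuleOver A 𝒜 :=
  letI := (subquotientGrading_isInternal hI hK).chooseDecomposition
  { carrier := I ⧸ K.submoduleOf I
    grading := subquotientGrading 𝒜 I K
    smul_mem := by
      rintro i j a _ ha ⟨r, hr, rfl⟩
      exact ⟨a • r, SetLike.mul_mem_graded ha hr, rfl⟩ }

end Subquotient

/-- A simple module over a graded left-artinian ring admits a grading. -/
theorem exists_isGradedSimple_linearEquiv [IsArtinian A A] (S : Type u) [AddCommGroup S]
    [Module A S] [IsSimpleModule A S] :
    ∃ M : GradedModuleOver A 𝒜, IsGradedSimple M ∧ Nonempty (M.carrier ≃ₗ[A] S) := by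
  have := IsSimpleModule.nontrivial A S
  obtain ⟨s, hs⟩ := exists_ne (0 : S)
  let L : Ideal A := (LinearMap.toSpanSingleton A S s).ker
  obtain ⟨I, ⟨hI, hIL⟩, hmin⟩ := IsArtinian.set_has_minimal
    {I : Ideal A | I.IsHomogeneous 𝒜 ∧ ¬ I ≤ L}
    ⟨⊤, fun _ _ _ => Submodule.mem_top, fun h => hs (by simpa [L] using h (x := 1) trivial)⟩
  let K : Ideal A := (L.homogeneousCore 𝒜).toIdeal
  have hK : K.IsHomogeneous 𝒜 := (L.homogeneousCore 𝒜).isHomogeneous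
  have hKL : K ≤ L := L.toIdeal_homogeneousCore_le 𝒜
  have hleK {J : Ideal A} (hJ : J.IsHomogeneous 𝒜) (hJL : J ≤ L) : J ≤ K := by
    rw [← hJ.toIdeal_homogeneousCore_eq_self]
    exact Ideal.homogeneousCore_mono 𝒜 hJL
  let π := (K.submoduleOf I).mkQ
  have hπ : Function.Surjective π := (K.submoduleOf I).mkQ_surjective
  have hM : IsGradedSimple (gradedSubquotient hI hK) := by
    constructor
    · change Nontrivial (I ⧸ K.submoduleOf I)
      rw [Submodule.Quotient.nontrivial_iff, Ne, Submodule.submoduleOf_eq_top]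
      exact fun h => hIL (h.trans hKL)
    · intro (p : Submodule A (I ⧸ K.submoduleOf I)) hp
      let J : Ideal A := (p.comap π).map I.subtype
      have hJI : J ≤ I := Submodule.map_subtype_le _ _
      have hJ : J.IsHomogeneous 𝒜 := by
        rintro j _ ⟨a, ha, rfl⟩
        refine ⟨⟨_, hI j a.2⟩, ?_, rfl⟩
        let := (subquotientGrading_isInternal hI hK).chooseDecomposition
        change π _ ∈ p
        exact decompose_subquotientGrading_mk (K := K) hI a j ▸ hp j _ ha
      by_cases hJL : J ≤ L
      · left
        rw [eq_bot_iff]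
        intro y hy
        obtain ⟨a, rfl⟩ := hπ y
        have haK : (a : A) ∈ K := hleK hJ hJL ⟨a, hy, rfl⟩
        exact (Submodule.Quotient.mk_eq_zero _).mpr haK
      · right
        have hJeq : J = I := eq_of_le_of_not_lt hJI (hmin J ⟨hJ, hJL⟩)
        rw [eq_top_iff]
        intro y _
        obtain ⟨a, rfl⟩ := hπ y
        obtain ⟨b, hb, hba⟩ : (a : A) ∈ J := hJeq.ge a.2
        exact (Subtype.ext hba : b = a) ▸ hb
  refine ⟨_, hM, ?_⟩
  have hsimple : IsSimpleModule A (I ⧸ K.submoduleOf I) := hM.isSimpleModule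
  let g : (I ⧸ K.submoduleOf I) →ₗ[A] S :=
    (K.submoduleOf I).liftQ (LinearMap.toSpanSingleton A S s ∘ₗ I.subtype) fun a ha => hKL ha
  have hg : g ≠ 0 := by
    intro h
    refine hIL fun a ha => ?_
    exact LinearMap.congr_fun h (π ⟨a, ha⟩)
  exact ⟨LinearEquiv.ofBijective g (LinearMap.bijective_of_ne_zero hg)⟩

end GradedSimple

/-- **Simple graded modules modulo shift ↔ simple ungraded modules.**
Let `A` be a `ℤ`-graded left-artinian ring.  Then every graded-simple graded
`A`-module is simple as an ungraded module, and forgetting the grading induces a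
bijection between isomorphism classes of simple `ℤ`-graded `A`-modules modulo
grading shift and isomorphism classes of simple ungraded `A`-modules. -/
theorem gradedSimple_modulo_shift_equiv_simple
    (A : Type u) [Ring A] [IsArtinian A A]
    (𝒜 : ℤ → AddSubgroup A) [GradedRing 𝒜] :
    (∀ M : GradedModuleOver A 𝒜, IsGradedSimple M → IsSimpleModule A M.carrier) ∧
    ∃ F : Quot (fun M N : {M : GradedModuleOver A 𝒜 // IsGradedSimple M} =>
            ShiftIsoRel M.1 N.1) →
          Quot (fun L L' : {L : ModuleOver A // IsSimpleModule A L.carrier} =>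
            Nonempty (L.1.carrier ≃ₗ[A] L'.1.carrier)),
      Function.Bijective F ∧
      ∀ (M : GradedModuleOver A 𝒜) (hM : IsGradedSimple M)
        (L : ModuleOver A) (hL : IsSimpleModule A L.carrier),
        Nonempty (M.carrier ≃ₗ[A] L.carrier) →
        F (Quot.mk _ ⟨M, hM⟩) = Quot.mk _ ⟨L, hL⟩ := by
  refine ⟨fun M hM => hM.isSimpleModule, ?_⟩
  have hequiv : Equivalence fun L L' : {L : ModuleOver A // IsSimpleModule A L.carrier} =>
      Nonempty (L.1.carrier ≃ₗ[A] L'.1.carrier) :=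
    ⟨fun _ => ⟨.refl A _⟩, fun ⟨e⟩ => ⟨e.symm⟩, fun ⟨e⟩ ⟨e'⟩ => ⟨e.trans e'⟩⟩
  refine ⟨Quot.map (fun M => ⟨⟨M.1.carrier⟩, M.2.isSimpleModule⟩) fun _ _ ⟨_, e, _⟩ => ⟨e⟩,
    ⟨?_, ?_⟩, fun M hM L hL he => Quot.sound he⟩
  · rintro ⟨M, hM⟩ ⟨N, hN⟩ h
    obtain ⟨e⟩ := (hequiv.quot_mk_eq_iff _ _).mp h
    have := hM.isSimpleModule
    have := hN.isSimpleModule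
    exact Quot.sound (ShiftIsoRel.of_linearEquiv e)
  · rintro ⟨L, hL⟩
    obtain ⟨M, hM, he⟩ := exists_isGradedSimple_linearEquiv (𝒜 := 𝒜) L.carrier
    exact ⟨Quot.mk _ ⟨M, hM⟩, Quot.sound he⟩
end

section
/- Let A be a ℤ-graded left-artinian ring and P a finitely generated projective A-module. Then P admits a ℤ-grading, i.e. there is a ℤ-graded A-module P̃ whose underlying ungraded module is isomorphic to P. -/
/-- Graded module structure: `𝒜 i • ℳ j ⊆ ℳ (i + j)`. -/
def IsGradedSMul {A M : Type*} [Ring A] [AddCommGroup M] [Module A M]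
    (𝒜 : ℤ → AddSubgroup A) (ℳ : ℤ → AddSubgroup M) : Prop :=
  ∀ ⦃i j : ℤ⦄ ⦃a : A⦄ ⦃m : M⦄, a ∈ 𝒜 i → m ∈ ℳ j → a • m ∈ ℳ (i + j)

open DirectSum

/-- A module is gradable when it carries a locally finite family of orthogonal additive projections
summing to the identity and shifted by homogeneous scalars. -/
def IsGradable {A : Type*} [Ring A] (𝒜 : ℤ → AddSubgroup A)
    (M : Type*) [AddCommGroup M] [Module A M] : Prop :=
  ∃ p : ℤ → M →+ M,
    (∀ i m, p i (p i m) = p i m) ∧ (∀ i j m, i ≠ j → p i (p j m) = 0) ∧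
    (∀ m, ∃ s : Finset ℤ, (∀ i, i ∉ s → p i m = 0) ∧ ∑ i ∈ s, p i m = m) ∧
    ∀ i j a m, a ∈ 𝒜 i → p (i + j) (a • m) = a • p j m

namespace IsGradable

variable {A : Type*} [Ring A] {𝒜 : ℤ → AddSubgroup A}
  {M N : Type*} [AddCommGroup M] [Module A M] [AddCommGroup N] [Module A N]

theorem of_subsingleton [Subsingleton M] : IsGradable 𝒜 M :=
  ⟨fun _ => 0, fun _ _ => Subsingleton.elim _ _, fun _ _ _ _ => Subsingleton.elim _ _,
    fun _ => ⟨∅, fun _ _ => Subsingleton.elim _ _, Subsingleton.elim _ _⟩,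
    fun _ _ _ _ _ => Subsingleton.elim _ _⟩

theorem of_equiv (e : M ≃ₗ[A] N) (h : IsGradable 𝒜 M) : IsGradable 𝒜 N := by
  obtain ⟨p, h1, h2, h3, h4⟩ := h
  refine ⟨fun i => (e.toAddEquiv.toAddMonoidHom.comp (p i)).comp e.symm.toAddEquiv.toAddMonoidHom,
    fun i m => ?_, fun i j m hij => ?_, fun m => ?_, fun i j a m ha => ?_⟩
  · simp [h1]
  · simp [h2 i j _ hij]
  · obtain ⟨s, hs, hm⟩ := h3 (e.symm m)
    refine ⟨s, fun i hi => by simp [hs i hi], ?_⟩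
    have := congrArg e hm
    simpa using this
  · simp [h4 i j a _ ha]

theorem prod (hM : IsGradable 𝒜 M) (hN : IsGradable 𝒜 N) : IsGradable 𝒜 (M × N) := by
  obtain ⟨p, h1, h2, h3, h4⟩ := hM
  obtain ⟨q, k1, k2, k3, k4⟩ := hN
  refine ⟨fun i => (p i).prodMap (q i),
    fun i m => ?_, fun i j m hij => ?_, fun m => ?_, fun i j a m ha => ?_⟩
  · exact Prod.ext (h1 i m.1) (k1 i m.2)
  · exact Prod.ext (h2 i j m.1 hij) (k2 i j m.2 hij)
  · obtain ⟨s, hs, hm⟩ := h3 m.1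
    obtain ⟨s', hs', hm'⟩ := k3 m.2
    refine ⟨s ∪ s', fun i hi => ?_, ?_⟩
    · rw [Finset.notMem_union] at hi
      exact Prod.ext (hs i hi.1) (hs' i hi.2)
    · refine Prod.ext ?_ ?_
      · rw [Prod.fst_sum]
        exact (Finset.sum_subset Finset.subset_union_left fun i _ hi => hs i hi).symm.trans hm
      · rw [Prod.snd_sum]
        exact (Finset.sum_subset Finset.subset_union_right fun i _ hi => hs' i hi).symm.trans hm'
  · exact Prod.ext (h4 i j a m.1 ha) (k4 i j a m.2 ha)

theorem exists_decomposition (h : IsGradable 𝒜 M) :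
    ∃ 𝒬 : ℤ → AddSubgroup M,
      Nonempty (DirectSum.Decomposition 𝒬) ∧ IsGradedSMul 𝒜 𝒬 := by
  obtain ⟨p, h1, h2, h3, h4⟩ := h
  have key : ∀ (x : ⨁ i, (p i).range) (j : ℤ),
      p j (DirectSum.coeAddMonoidHom (fun i => (p i).range) x) = x j := by
    intro x j
    induction x using DirectSum.induction_on with
    | zero => simp
    | of i y =>
      obtain ⟨_, y, rfl⟩ := y
      rw [DirectSum.coeAddMonoidHom_of]
      by_cases hij : j = i
      · subst hij
        rw [DirectSum.of_eq_same]
        exact h1 _ _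
      · rw [DirectSum.of_eq_of_ne _ _ _ hij]
        exact h2 _ _ _ hij
    | add x y hx hy => simp [hx, hy]
  have hint : DirectSum.IsInternal (fun i => (p i).range) := by
    refine ⟨(injective_iff_map_eq_zero _).2 fun x hx => ?_, fun m => ?_⟩
    · refine DFinsupp.ext fun j => Subtype.ext ?_
      rw [← key x j, hx]
      simp
    · obtain ⟨s, -, hm⟩ := h3 m
      refine ⟨∑ i ∈ s, DirectSum.of (fun i => (p i).range) i ⟨p i m, m, rfl⟩, ?_⟩
      simpa using hm
  refine ⟨fun i => (p i).range, ⟨hint.chooseDecomposition⟩, ?_⟩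
  rintro i j a _ ha ⟨m, rfl⟩
  exact ⟨a • m, h4 i j a m ha⟩

end IsGradable

section Idempotents

variable {A : Type*} [Ring A]

theorem mem_span_idempotent_iff {e x : A} (he : e * e = e) :
    x ∈ Ideal.span {e} ↔ x * e = x := by
  rw [Ideal.mem_span_singleton']
  constructor
  · rintro ⟨a, rfl⟩
    rw [mul_assoc, he]
  · exact fun h => ⟨x, h⟩

/-- Over a left artinian ring, right multiplication by `c` on `Ae` is injective iff it is
surjective. -/
theorem rightMul_injective_iff_surjective [IsArtinian A A] {e c : A} (he : e * e = e)
    (hc : c * e = c) :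
    (∀ l, l * e = l → l * c = 0 → l = 0) ↔ ∃ y, y * e = y ∧ y * c = e := by
  have : IsArtinianRing A := ‹IsArtinian A A›
  have : IsNoetherian A A := inferInstance
  let φ : Ideal.span {e} →ₗ[A] Ideal.span {e} :=
    (LinearMap.toSpanSingleton A A c).restrict fun x _ =>
      (mem_span_idempotent_iff he).2 (by simp [mul_assoc, hc])
  have hφ : ∀ x, (φ x : A) = x * c := fun x => rfl
  constructor
  · intro h
    have hinj : Function.Injective φ := (injective_iff_map_eq_zero φ).2 fun x hx =>
      Subtype.ext (h x ((mem_span_idempotent_iff he).1 x.2) (by rw [← hφ, hx]; rfl))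
    obtain ⟨y, hy⟩ := IsArtinian.surjective_of_injective_endomorphism φ hinj
      ⟨e, Ideal.mem_span_singleton_self e⟩
    exact ⟨y, (mem_span_idempotent_iff he).1 y.2, by rw [← hφ, hy]⟩
  · rintro ⟨y, hye, hyc⟩ l hl hlc
    have hsurj : Function.Surjective φ := fun x =>
      ⟨⟨x * y, (mem_span_idempotent_iff he).2 (by rw [mul_assoc, hye])⟩, Subtype.ext (by
        rw [hφ, mul_assoc, hyc, (mem_span_idempotent_iff he).1 x.2])⟩
    have hinj := IsNoetherian.injective_of_surjective_endomorphism φ hsurj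
    have : (⟨l, (mem_span_idempotent_iff he).2 hl⟩ : Ideal.span {e}) = 0 :=
      hinj (Subtype.ext (by rw [hφ, map_zero]; exact hlc))
    exact congrArg Subtype.val this

variable (𝒜 : ℤ → AddSubgroup A) [GradedRing 𝒜]

theorem decompose_mul_of_mem_zero {e : A} (he : e ∈ 𝒜 0) (x : A) (i : ℤ) :
    (decompose 𝒜 (x * e) i : A) = decompose 𝒜 x i * e := by
  have := coe_decompose_mul_add_of_right_mem 𝒜 (i := i) (a := x) he
  rwa [add_zero] at this

theorem decompose_mul_of_zero_mem {e : A} (he : e ∈ 𝒜 0) (x : A) (i : ℤ) :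
    (decompose 𝒜 (e * x) i : A) = e * decompose 𝒜 x i := by
  have := coe_decompose_mul_add_of_left_mem 𝒜 (j := i) (b := x) he
  rwa [zero_add] at this

theorem isHomogeneous_map_rightMul {L : Ideal A} (hL : L.IsHomogeneous 𝒜) {n : ℤ} {a : A}
    (ha : a ∈ 𝒜 n) :
    (Submodule.map (LinearMap.toSpanSingleton A A a) L : Ideal A).IsHomogeneous 𝒜 := by
  rintro i _ ⟨x, hx, rfl⟩
  refine ⟨decompose 𝒜 x (i - n), hL _ hx, ?_⟩
  have := coe_decompose_mul_add_of_right_mem 𝒜 (i := i - n) (a := x) ha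
  rw [sub_add_cancel] at this
  exact this.symm

theorem isGradable_span_idempotent {e : A} (he0 : e ∈ 𝒜 0) (he : e * e = e) :
    IsGradable 𝒜 (Ideal.span {e}) := by
  have hmem : ∀ i, ∀ x ∈ Ideal.span {e}, (decompose 𝒜 x i : A) ∈ Ideal.span {e} := by
    intro i x hx
    rw [mem_span_idempotent_iff he] at hx ⊢
    rw [← decompose_mul_of_mem_zero 𝒜 he0, hx]
  refine ⟨fun i => AddMonoidHom.mk' (fun x => ⟨decompose 𝒜 (x : A) i, hmem i x x.2⟩)
    (fun x y => Subtype.ext (by simp)), fun i x => Subtype.ext ?_,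
    fun i j x hij => Subtype.ext ?_, fun x => ?_, fun i j a x ha => Subtype.ext ?_⟩
  · exact decompose_of_mem_same 𝒜 (SetLike.coe_mem _)
  · exact decompose_of_mem_ne 𝒜 (SetLike.coe_mem _) hij.symm
  · classical
    refine ⟨(decompose 𝒜 (x : A)).support, fun i hi => Subtype.ext ?_, Subtype.ext ?_⟩
    · simpa using hi
    · simpa using sum_support_decompose 𝒜 (x : A)
  · exact coe_decompose_mul_add_of_left_mem 𝒜 ha

/-- A component whose nonvanishing propagates along an arithmetic progression is zero. -/
theorem decompose_eq_zero_of_progression (x : A) (i : ℤ) {n : ℤ} (hn : n ≠ 0)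
    (h : ∀ k : ℕ, (decompose 𝒜 x (i + k * n) : A) ≠ 0 →
      (decompose 𝒜 x (i + k * n + n) : A) ≠ 0) :
    (decompose 𝒜 x i : A) = 0 := by
  classical
  by_contra hi
  have hne : ∀ k : ℕ, (decompose 𝒜 x (i + k * n) : A) ≠ 0 := by
    intro k
    induction k with
    | zero =>
      rwa [show i + ((0 : ℕ) : ℤ) * n = i by simp]
    | succ k ih =>
      rw [show i + ((k + 1 : ℕ) : ℤ) * n = i + k * n + n by push_cast; ring]
      exact h k ih
  refine Set.infinite_of_injective_forall_mem (f := fun k : ℕ => i + k * n) (fun k l hkl => ?_)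
    (fun k => ?_) (decompose 𝒜 x).support.finite_toSet
  · have : (k : ℤ) * n = l * n := add_left_cancel hkl
    exact_mod_cast mul_right_cancel₀ hn this
  · have := hne k
    simp only [Finset.mem_coe, DFinsupp.mem_support_iff]
    exact fun h0 => this (by rw [h0]; rfl)

/-- In a graded left artinian ring, a unit of the corner `eAe` can be homogeneous only of
degree zero. -/
theorem degree_eq_zero_of_leftInverse [IsArtinian A A] {e u y : A} {n : ℤ} (he0 : e ∈ 𝒜 0)
    (he : e * e = e) (hne : e ≠ 0) (hu : u ∈ 𝒜 n) (heu : e * u = u) (hue : u * e = u)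
    (hy : y * u = e) : n = 0 := by
  by_contra hn
  have hinj := (rightMul_injective_iff_surjective he hue).2
    ⟨y * e, by rw [mul_assoc, he], by rw [mul_assoc, heu, hy]⟩
  have hcomp : ∀ l : A, l * e = l → ∀ i, (decompose 𝒜 l i : A) * e = decompose 𝒜 l i := by
    intro l hl i
    rw [← decompose_mul_of_mem_zero 𝒜 he0, hl]
  have hmul : ∀ (l : A) (i : ℤ),
      (decompose 𝒜 (l * u) (i + n) : A) = decompose 𝒜 l i * u :=
    fun l i => coe_decompose_mul_add_of_right_mem 𝒜 hu
  obtain ⟨l, hle, hl⟩ := (rightMul_injective_iff_surjective (c := e - u) he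
    (by rw [sub_mul, he, hue])).1 (by
      intro l hl hlu
      rw [mul_sub, hl, sub_eq_zero] at hlu
      have hzero : ∀ i, (decompose 𝒜 l i : A) = 0 := by
        refine fun i => decompose_eq_zero_of_progression 𝒜 l i hn fun k hk h0 => hk ?_
        refine hinj _ (hcomp l hl _) ?_
        rw [← hmul, ← hlu, h0]
      apply (decompose 𝒜).injective
      rw [decompose_zero]
      exact DFinsupp.ext fun i => Subtype.ext (hzero i))
  rw [mul_sub, hle] at hl
  have hrec : ∀ i, (decompose 𝒜 l (i + n) : A) - decompose 𝒜 l i * u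
      = decompose 𝒜 e (i + n) := by
    intro i
    rw [← hmul, ← hl, decompose_sub]
    rfl
  have hrec' : ∀ i, i + n ≠ 0 → (decompose 𝒜 l (i + n) : A) = decompose 𝒜 l i * u := by
    intro i hi
    rw [← sub_eq_zero, hrec, decompose_of_mem_ne 𝒜 he0 hi.symm]
  have hl0 : (decompose 𝒜 l 0 : A) = 0 := by
    refine decompose_eq_zero_of_progression 𝒜 l 0 hn fun k hk h0 => hk ?_
    refine hinj _ (hcomp l hle _) ?_
    rw [← hrec', h0]
    have : ((k : ℤ) + 1) * n ≠ 0 := mul_ne_zero (by positivity) hn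
    intro h
    apply this
    linarith
  have hln : (decompose 𝒜 l (-n) : A) = 0 := by
    refine decompose_eq_zero_of_progression 𝒜 l (-n) (neg_ne_zero.2 hn) fun k hk h0 => hk ?_
    have hidx : -n + k * (-n) + -n + n = -n + k * (-n) := by ring
    have hr := hrec' (-n + k * (-n) + -n) (by
      have : ((k : ℤ) + 1) * n ≠ 0 := mul_ne_zero (by positivity) hn
      intro h
      apply this
      linarith)
    rwa [h0, zero_mul, hidx] at hr
  have := hrec (-n)
  rw [hln, neg_add_cancel, hl0, decompose_of_mem_same 𝒜 he0, zero_mul, sub_zero] at this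
  exact hne this.symm

theorem exists_smul_eq_of_smul_ne_zero {S : Type*} [AddCommGroup S] [Module A S]
    [IsSimpleModule A S] {L : Ideal A} {x : A} (hx : x ∈ L) {s : S} (hs : x • s ≠ 0) (t : S) :
    ∃ y ∈ L, y • s = t := by
  have h : Submodule.map (LinearMap.toSpanSingleton A S s) L = ⊤ := by
    refine (eq_bot_or_eq_top _).resolve_left fun h => hs ?_
    rw [← Submodule.mem_bot A, ← h]
    exact ⟨x, hx, rfl⟩
  have ht : t ∈ Submodule.map (LinearMap.toSpanSingleton A S s) L := h ▸ Submodule.mem_top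
  exact ht

/-- A homogeneous left ideal not annihilating a simple module `S` contains a degree-zero
idempotent `e` acting nontrivially on `S` such that every homogeneous element of `Ae` acting
nontrivially on `S` generates `Ae`. -/
theorem exists_idempotent_of_smul_ne_zero [IsArtinian A A]
    {S : Type*} [AddCommGroup S] [Module A S] [IsSimpleModule A S]
    {N : Ideal A} (hN : N.IsHomogeneous 𝒜) (hS : ∃ x ∈ N, ∃ s : S, x • s ≠ 0) :
    ∃ e ∈ N, e ∈ 𝒜 0 ∧ e * e = e ∧ (∃ t : S, t ≠ 0 ∧ e • t = t) ∧
      ∀ x n, x ∈ 𝒜 n → x * e = x → (∃ s : S, x • s ≠ 0) → ∃ y, y * x = e := by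
  classical
  have : IsArtinianRing A := ‹IsArtinian A A›
  have : IsNoetherian A A := inferInstance
  obtain ⟨L, ⟨hLN, hL, x₀, hx₀, s, hs⟩, hmin⟩ := IsArtinian.set_has_minimal
    {I : Submodule A A | I ≤ N ∧ Ideal.IsHomogeneous 𝒜 I ∧ ∃ x ∈ I, ∃ s : S, x • s ≠ 0}
    ⟨N, le_rfl, hN, hS⟩
  have hmin' : ∀ (a : A) (n : ℤ), a ∈ 𝒜 n → a ∈ L → ∀ K : Ideal A, K.IsHomogeneous 𝒜 →
      (∃ x ∈ K, ∃ s : S, (x * a) • s ≠ 0) →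
      Submodule.map (LinearMap.toSpanSingleton A A a) K = L := by
    rintro a n ha haL K hK ⟨x, hx, s, hs⟩
    have hle : Submodule.map (LinearMap.toSpanSingleton A A a) K ≤ L := by
      rintro _ ⟨z, -, rfl⟩
      exact L.smul_mem z haL
    exact eq_of_le_of_not_lt hle (hmin _ ⟨hle.trans hLN, isHomogeneous_map_rightMul 𝒜 hK ha,
      x * a, ⟨x, hx, rfl⟩, s, hs⟩)
  obtain ⟨y, hy, hys⟩ := exists_smul_eq_of_smul_ne_zero hx₀ hs s
  obtain ⟨i, hi⟩ : ∃ i, (x₀ * (decompose 𝒜 y i : A)) • s ≠ 0 := by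
    by_contra! h
    apply hs
    rw [← hys, ← sum_support_decompose 𝒜 y, Finset.sum_smul, Finset.smul_sum]
    exact Finset.sum_eq_zero fun i _ => by rw [← mul_smul, h]
  obtain ⟨a, hai, haL, hi⟩ : ∃ a ∈ 𝒜 i, a ∈ L ∧ (x₀ * a) • s ≠ 0 :=
    ⟨_, SetLike.coe_mem _, hL i hy, hi⟩
  have hLa := hmin' a i hai haL L hL ⟨x₀, hx₀, s, hi⟩
  let φ : L →ₗ[A] L := (LinearMap.toSpanSingleton A A a).restrict fun x _ => L.smul_mem x haL
  have hsurj : Function.Surjective φ := by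
    rintro ⟨z, hz⟩
    rw [← hLa] at hz
    obtain ⟨x, hx, rfl⟩ := hz
    exact ⟨⟨x, hx⟩, rfl⟩
  have hinj : ∀ z ∈ L, ∀ w ∈ L, z * a = w * a → z = w := fun z hz w hw h =>
    congrArg Subtype.val (IsNoetherian.injective_of_surjective_endomorphism φ hsurj
      (a₁ := ⟨z, hz⟩) (a₂ := ⟨w, hw⟩) (Subtype.ext h))
  obtain ⟨⟨x, hx⟩, hxa⟩ := hsurj ⟨a, haL⟩
  have hxa : x * a = a := congrArg Subtype.val hxa
  obtain ⟨e, he0, heL, hea⟩ : ∃ e ∈ 𝒜 0, e ∈ L ∧ e * a = a := by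
    refine ⟨decompose 𝒜 x 0, SetLike.coe_mem _, hL 0 hx, ?_⟩
    have := coe_decompose_mul_add_of_right_mem 𝒜 (i := 0) (a := x) hai
    rw [hxa, zero_add, decompose_of_mem_same 𝒜 hai] at this
    exact this.symm
  have hLe : ∀ l ∈ L, l * e = l := fun l hl =>
    hinj _ (L.smul_mem l heL) _ hl (by rw [smul_eq_mul, mul_assoc, hea])
  refine ⟨e, hLN heL, he0, hLe e heL, ⟨a • s, ?_, by rw [← mul_smul, hea]⟩, ?_⟩
  · intro h
    exact hi (by rw [mul_smul, h, smul_zero])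
  · rintro z n hz hze ⟨s', hs'⟩
    have hzL : z ∈ L := hze ▸ L.smul_mem z heL
    have := hmin' z n hz hzL ⊤ (fun _ _ _ => trivial) ⟨1, trivial, s', by rwa [one_mul]⟩
    rw [← this] at heL
    obtain ⟨y, -, hy⟩ := heL
    exact ⟨y, hy⟩

/-- The corner at an idempotent as in `exists_idempotent_of_smul_ne_zero` is local: elements fixing
a nonzero vector of `S` are left invertible. -/
theorem exists_leftInverse_of_smul_eq [IsArtinian A A]
    {S : Type*} [AddCommGroup S] [Module A S] {e : A} (he0 : e ∈ 𝒜 0) (he : e * e = e)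
    {t : S} (ht : t ≠ 0) (het : e • t = t)
    (hmin : ∀ x n, x ∈ 𝒜 n → x * e = x → (∃ s : S, x • s ≠ 0) → ∃ y, y * x = e)
    {c : A} (hce : c * e = c) (hec : e * c = c) (hct : c • t = t) :
    ∃ y, y * c = e := by
  classical
  have hne : e ≠ 0 := by
    rintro rfl
    exact ht (by rw [← het, zero_smul])
  by_contra hno
  have hproper : Ideal.span {c, 1 - e} ≠ ⊤ := by
    rw [Ne, Ideal.eq_top_iff_one, Ideal.mem_span_pair]
    rintro ⟨y, z, h⟩
    apply hno
    refine ⟨y, ?_⟩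
    have := congrArg (· * e) h
    simpa [add_mul, mul_assoc, hce, sub_mul, he] using this
  obtain ⟨M, hM, hXM⟩ := Ideal.exists_le_maximal _ hproper
  have hcM : c ∈ M := hXM (Ideal.subset_span (by simp))
  have heM : e ∉ M := fun h => hM.ne_top ((Ideal.eq_top_iff_one M).2 (by
    simpa using M.add_mem h (hXM (Ideal.subset_span (by simp : 1 - e ∈ ({c, 1 - e} : Set A))))))
  have hMc : IsCoatom M := hM.out
  have : IsSimpleModule A (A ⧸ M) := isSimpleModule_iff_isCoatom.2 hMc
  let N : Ideal A := Ideal.span {x | SetLike.IsHomogeneousElem 𝒜 x ∧ x * e = x ∧ ∀ s : S, x • s = 0}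
  have hN : N.IsHomogeneous 𝒜 := Ideal.homogeneous_span 𝒜 _ fun x hx => hx.1
  have hNe : ∀ x ∈ N, x * e = x ∧ ∀ s : S, x • s = 0 := by
    intro x hx
    induction hx using Submodule.span_induction with
    | mem x hx => exact hx.2
    | zero => simp
    | add x y _ _ hx hy =>
      exact ⟨by rw [add_mul, hx.1, hy.1], fun s => by rw [add_smul, hx.2, hy.2, add_zero]⟩
    | smul a x _ hx =>
      exact ⟨by rw [smul_eq_mul, mul_assoc, hx.1],
        fun s => by rw [smul_eq_mul, mul_smul, hx.2, smul_zero]⟩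
  have hNM : N ≤ M := by
    intro x hx
    by_contra hxM
    obtain ⟨f, hfN, hf0, hf, ⟨t', ht', hft'⟩, -⟩ :=
      exists_idempotent_of_smul_ne_zero 𝒜 (S := A ⧸ M) hN
        ⟨x, hx, Submodule.Quotient.mk 1, by
          rw [← Submodule.Quotient.mk_smul, Ne, Submodule.Quotient.mk_eq_zero]
          simpa using hxM⟩
    obtain ⟨hfe, hfS⟩ := hNe f hfN
    have hef0 : e * f ∈ 𝒜 0 := by simpa using SetLike.mul_mem_graded he0 hf0
    obtain ⟨y, hy⟩ := hmin (e - e * f) 0 (sub_mem he0 hef0)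
      (by rw [sub_mul, he, mul_assoc, hfe])
      ⟨t, by rw [sub_smul, het, mul_smul, hfS, smul_zero, sub_zero]; exact ht⟩
    have hzero : e * f = 0 := by
      calc e * f = y * ((e - e * f) * f) := by rw [← mul_assoc, hy]
        _ = 0 := by rw [sub_mul, mul_assoc, hf, sub_self, mul_zero]
    have : f = 0 := by
      calc f = f * e * f := by rw [hfe, hf]
        _ = 0 := by rw [mul_assoc, hzero, mul_zero]
    exact ht' (by rw [← hft', this, zero_smul])
  have hcomp_e : ∀ i, (decompose 𝒜 c i : A) * e = decompose 𝒜 c i := fun i => by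
    rw [← decompose_mul_of_mem_zero 𝒜 he0, hce]
  have hcomp_N : ∀ i, i ≠ 0 → (decompose 𝒜 c i : A) ∈ N := by
    intro i hi
    refine Ideal.subset_span ⟨⟨i, SetLike.coe_mem _⟩, hcomp_e i, ?_⟩
    by_contra! h
    obtain ⟨y, hy⟩ := hmin _ i (SetLike.coe_mem _) (hcomp_e i) h
    exact hi (degree_eq_zero_of_leftInverse 𝒜 he0 he hne (SetLike.coe_mem _)
      (by rw [← decompose_mul_of_zero_mem 𝒜 he0, hec]) (hcomp_e i) hy)
  have hdiff : c - decompose 𝒜 c 0 ∈ N := by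
    have hsum : c - decompose 𝒜 c 0
        = ∑ i ∈ (decompose 𝒜 c).support.erase 0, (decompose 𝒜 c i : A) := by
      rw [sub_eq_iff_eq_add]
      by_cases h0 : (0 : ℤ) ∈ (decompose 𝒜 c).support
      · rw [Finset.sum_erase_add _ _ h0, sum_support_decompose]
      · rw [Finset.erase_eq_of_notMem h0, sum_support_decompose]
        rw [DFinsupp.notMem_support_iff] at h0
        simp [h0]
    rw [hsum]
    exact N.sum_mem fun i hi => hcomp_N i (Finset.ne_of_mem_erase hi)
  have hc0t : (decompose 𝒜 c 0 : A) • t = t := by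
    have := (hNe _ hdiff).2 t
    rw [sub_smul, hct, sub_eq_zero] at this
    exact this.symm
  obtain ⟨y, hy⟩ := hmin _ 0 (SetLike.coe_mem _) (hcomp_e 0) ⟨t, by rw [hc0t]; exact ht⟩
  apply heM
  rw [← hy]
  refine M.mul_mem_left _ ?_
  simpa using M.sub_mem hcM (hNM hdiff)

theorem exists_split_idempotent [IsArtinian A A] (P : Type*) [AddCommGroup P] [Module A P]
    [Module.Finite A P] [Module.Projective A P] [Nontrivial P] :
    ∃ e : A, e ∈ 𝒜 0 ∧ e * e = e ∧ e ≠ 0 ∧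
      ∃ (g : Ideal.span {e} →ₗ[A] P) (f : P →ₗ[A] Ideal.span {e}), f ∘ₗ g = LinearMap.id := by
  obtain ⟨M, hM, -⟩ := (eq_top_or_exists_le_coatom (⊥ : Submodule A P)).resolve_left bot_ne_top
  have : IsSimpleModule A (P ⧸ M) := isSimpleModule_iff_isCoatom.2 hM
  have : Nontrivial (P ⧸ M) := IsSimpleModule.nontrivial A _
  obtain ⟨s, hs⟩ := exists_ne (0 : P ⧸ M)
  obtain ⟨e, -, he0, he, ⟨t, ht, het⟩, hmin⟩ :=
    exists_idempotent_of_smul_ne_zero 𝒜 (S := P ⧸ M) (N := ⊤) (fun _ _ _ => trivial)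
      ⟨1, trivial, s, by rwa [one_smul]⟩
  obtain ⟨p, rfl⟩ := M.mkQ_surjective t
  let π : Ideal.span {e} →ₗ[A] P ⧸ M :=
    (LinearMap.toSpanSingleton A _ (M.mkQ p)).comp (Submodule.subtype _)
  have hπ : ∀ l, π l = (l : A) • M.mkQ p := fun l => rfl
  have hsurj : Function.Surjective π := fun q => by
    obtain ⟨y, hy, hyq⟩ := exists_smul_eq_of_smul_ne_zero (Ideal.mem_span_singleton_self e)
      (by rwa [het]) q
    exact ⟨⟨y, hy⟩, hyq⟩
  obtain ⟨f, hf⟩ := Module.projective_lifting_property π M.mkQ hsurj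
  have hf' : ∀ x, (f x : A) • M.mkQ p = M.mkQ x := fun x => LinearMap.congr_fun hf x
  have hec : (f (e • p) : A) = e * f p := by rw [map_smul]; rfl
  obtain ⟨y, hy⟩ := exists_leftInverse_of_smul_eq 𝒜 he0 he ht het hmin (c := f (e • p))
    ((mem_span_idempotent_iff he).1 (f _).2) (by rw [hec, ← mul_assoc, he])
    (by rw [hf', map_smul, het])
  refine ⟨e, he0, he, ?_,
    (LinearMap.toSpanSingleton A P (y • e • p)).comp (Submodule.subtype _), f, ?_⟩
  · rintro rfl
    exact ht (by rw [← het, zero_smul])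
  · refine LinearMap.ext fun l => Subtype.ext ?_
    have : (f ((l : A) • y • e • p) : A) = l * (y * f (e • p)) := by
      rw [map_smul, map_smul]
      rfl
    refine this.trans ?_
    rw [hy]
    exact (mem_span_idempotent_iff he).1 l.2

theorem isGradable_of_projective [IsArtinian A A] (P : Type*) [AddCommGroup P] [Module A P]
    [Module.Finite A P] [Module.Projective A P] : IsGradable 𝒜 P := by
  have : IsArtinianRing A := ‹IsArtinian A A›
  have : IsNoetherian A P := inferInstance
  have : IsArtinian A P := inferInstance
  suffices ∀ Q : Submodule A P, Module.Projective A Q → IsGradable 𝒜 Q from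
    (this ⊤ (.of_equiv Submodule.topEquiv.symm)).of_equiv Submodule.topEquiv
  intro Q
  induction Q using WellFoundedLT.induction with
  | ind Q ih =>
    intro hQ
    rcases subsingleton_or_nontrivial Q with hsub | hnt
    · exact .of_subsingleton
    obtain ⟨e, he0, he, hne, g, f, hfg⟩ := exists_split_idempotent 𝒜 Q
    have hfg' : ∀ l, f (g l) = l := fun l => LinearMap.congr_fun hfg l
    let K := LinearMap.ker f
    let ψ : (Ideal.span {e} × K) ≃ₗ[A] Q := LinearEquiv.ofBijective (g.coprod K.subtype) <| by
      refine ⟨(injective_iff_map_eq_zero _).2 ?_, fun q => ?_⟩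
      · rintro ⟨l, k, hk⟩ h
        have h : g l + k = 0 := h
        have hl : l = 0 := by
          have := congrArg f h
          rwa [map_add, hfg', LinearMap.mem_ker.1 hk, add_zero, map_zero] at this
        subst hl
        rw [map_zero, zero_add] at h
        subst h
        rfl
      · exact ⟨(f q, ⟨q - g (f q), by simp [K, hfg']⟩), by simp⟩
    have hK : Module.Projective A K := by
      refine .of_split (ψ.toLinearMap ∘ₗ LinearMap.inr A _ K)
        (LinearMap.snd A _ K ∘ₗ ψ.symm.toLinearMap) (LinearMap.ext fun k => ?_)
      simp
    let θ : K ≃ₗ[A] K.map Q.subtype := Submodule.equivMapOfInjective _ Q.injective_subtype K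
    have hlt : K.map Q.subtype < Q := by
      refine lt_of_le_of_ne (Submodule.map_subtype_le _ _) fun h => hne ?_
      have hmem : (g ⟨e, Ideal.mem_span_singleton_self e⟩ : P) ∈ K.map Q.subtype :=
        h.symm ▸ SetLike.coe_mem _
      obtain ⟨k, hk, hke⟩ := hmem
      have hke : k = g ⟨e, Ideal.mem_span_singleton_self e⟩ := Subtype.ext hke
      have : f k = 0 := hk
      rw [hke, hfg'] at this
      exact congrArg Subtype.val this
    exact ((isGradable_span_idempotent 𝒜 he0 he).prod
      ((ih _ hlt (.of_equiv θ)).of_equiv θ.symm)).of_equiv ψ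

end Idempotents

/-- **Projective modules admit graded lifts.**
Let `A` be a `ℤ`-graded left-artinian ring and `P` a finitely generated
projective `A`-module.  Then `P` admits a `ℤ`-grading compatible with the
grading of `A`: there is a family of additive subgroups `𝒬 i ⊆ P` forming a
direct sum decomposition of `P` with `𝒜 i • 𝒬 j ⊆ 𝒬 (i + j)`. -/
theorem projective_admits_grading
    {A : Type*} [Ring A] [IsArtinian A A]
    (𝒜 : ℤ → AddSubgroup A) [GradedRing 𝒜]
    (P : Type*) [AddCommGroup P] [Module A P]
    [Module.Finite A P] [Module.Projective A P] :
    ∃ 𝒬 : ℤ → AddSubgroup P,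
      Nonempty (DirectSum.Decomposition 𝒬) ∧ IsGradedSMul 𝒜 𝒬 :=
  (isGradable_of_projective 𝒜 P).exists_decomposition
end

section
/- Let A be a ℤ-graded left-artinian ring, (e_x)_{x∈I} a complete system of primitive pairwise orthogonal homogeneous idempotents, and M̃ any ℤ-graded A-module whose underlying ungraded module is isomorphic to A as a left A-module. Then there exists a function n : I → ℤ and an isomorphism of graded left A-modules M̃ ≅ ⊕_{x∈I} (A e_x)(n(x)). -/
theorem toSpanSingleton_pow_apply {A : Type*} [Ring A] (r a : A) (n : ℕ) :
    ((LinearMap.toSpanSingleton A A r : Module.End A A) ^ n) a = a * r ^ n := by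
  induction n generalizing a with
  | zero => simp
  | succ n ih =>
    rw [pow_succ, Module.End.mul_apply, ih, LinearMap.toSpanSingleton_apply, smul_eq_mul,
      pow_succ', mul_assoc]

/-- Fitting's lemma for right multiplication by an element `r` of the corner `e A e`, where `e` is a
primitive idempotent of a left-artinian ring. -/
theorem IsPrimitiveIdempotent.exists_pow_eq_zero_or_exists_mul_pow_eq {A : Type*} [Ring A]
    [IsArtinianRing A] {e : A} (he : IsPrimitiveIdempotent e) {r : A} (her : e * r = r)
    (hre : r * e = r) :
    ∃ n : ℕ, r ^ (n + 1) = 0 ∨ ∃ c : A, c * r ^ (n + 1) = e := by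
  obtain ⟨N, hN⟩ := Filter.eventually_atTop.mp
    (LinearMap.eventually_isCompl_ker_pow_range_pow
      (LinearMap.toSpanSingleton A A r : Module.End A A))
  specialize hN (N + 1) N.le_succ
  set F : Module.End A A := (LinearMap.toSpanSingleton A A r : Module.End A A) ^ (N + 1)
  have hFa (a : A) : F a = a * r ^ (N + 1) := toSpanSingleton_pow_apply r a (N + 1)
  have hpow : r ^ (N + 1) * e = r ^ (N + 1) := by rw [pow_succ, mul_assoc, hre]
  have hpow' : e * r ^ (N + 1) = r ^ (N + 1) := by rw [pow_succ', ← mul_assoc, her]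
  obtain ⟨p, hp, q, hq, hpq⟩ := Submodule.mem_sup.mp
    (hN.sup_eq_top ▸ Submodule.mem_top : e ∈ LinearMap.ker F ⊔ LinearMap.range F)
  have hqe : q * e = q := by
    obtain ⟨c, rfl⟩ := hq
    rw [hFa, mul_assoc, hpow]
  have hpe : p * e = p := by
    have h := he.1.eq
    nth_rewrite 1 [← hpq] at h
    rw [add_mul, hqe, ← hpq, mul_add] at h
    rw [← hpq, mul_add]
    exact add_right_cancel h
  have unique {a b : A} (ha : a ∈ LinearMap.ker F) (hb : b ∈ LinearMap.range F)
      (hab : a = b) : a = 0 :=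
    Submodule.disjoint_def.mp hN.disjoint a ha (hab ▸ hb)
  have mul_mem_ker (a : A) : a * p ∈ LinearMap.ker F := Submodule.smul_mem _ a hp
  have mul_mem_range (a : A) : a * q ∈ LinearMap.range F := Submodule.smul_mem _ a hq
  have hp_sub : p - p * p = 0 := by
    refine unique (sub_mem hp (mul_mem_ker p)) (mul_mem_range p) ?_
    rw [sub_eq_iff_eq_add', ← mul_add, hpq, hpe]
  have hq_sub : q * p = 0 := by
    refine unique (mul_mem_ker q) (sub_mem hq (mul_mem_range q)) ?_
    rw [eq_sub_iff_add_eq, ← mul_add, hpq, hqe]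
  have hpp : p * p = p := (sub_eq_zero.mp hp_sub).symm
  have hpq' : p * q = 0 := by
    have h := hpe
    rwa [← hpq, mul_add, hpp, add_eq_left] at h
  have hqq : q * q = q := by
    have h := hqe
    rwa [← hpq, mul_add, hq_sub, zero_add] at h
  refine ⟨N, ?_⟩
  rcases he.2.2 p q hpp hqq hpq' hq_sub hpq.symm with rfl | rfl
  · obtain ⟨c, hc⟩ := hq
    exact Or.inr ⟨c, by rw [← hFa, hc, ← hpq, zero_add]⟩
  · rw [add_zero] at hpq
    left
    rw [← hpow', ← hFa, ← hpq]
    exact hp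

/-- A nontrivial ring in which every element is nilpotent or left invertible is local. -/
theorem IsLocalRing.of_isNilpotent_or_exists_mul_eq_one {R : Type*} [Ring R] [Nontrivial R]
    (h : ∀ r : R, IsNilpotent r ∨ ∃ s, s * r = 1) : IsLocalRing R := by
  refine .of_isUnit_or_isUnit_one_sub_self fun r => ?_
  rcases h r with hr | ⟨s, hs⟩
  · exact Or.inr hr.isUnit_one_sub
  · left
    rcases h s with ⟨n, hn⟩ | ⟨t, ht⟩
    · have key : s ^ n * r ^ n = 1 := by
        clear hn
        induction n with
        | zero => simp
        | succ n ih => rw [pow_succ, pow_succ', mul_assoc, ← mul_assoc s, hs, one_mul, ih]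
      rw [hn, zero_mul] at key
      exact absurd key zero_ne_one
    · have htr : t = r := left_inv_eq_right_inv ht hs
      exact ⟨⟨r, s, htr ▸ ht, hs⟩, rfl⟩

theorem IsPrimitiveIdempotent.isLocalRing_corner {A : Type*} [Ring A] [IsArtinianRing A] {e : A}
    (he : IsPrimitiveIdempotent e) : IsLocalRing he.1.Corner := by
  have val_pow (r : he.1.Corner) (n : ℕ) : (r ^ (n + 1)).1 = r.1 ^ (n + 1) := by
    induction n with
    | zero => simp
    | succ n ih =>
      rw [pow_succ, pow_succ _ (n + 1), ← ih]
      rfl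
  have : Nontrivial he.1.Corner := ⟨⟨0, 1, fun h => he.2.1 (congrArg Subtype.val h).symm⟩⟩
  refine .of_isNilpotent_or_exists_mul_eq_one fun r => ?_
  obtain ⟨her, hre⟩ := (Subsemigroup.mem_corner_iff he.1).mp r.2
  obtain ⟨n, hn | ⟨c, hc⟩⟩ := he.exists_pow_eq_zero_or_exists_mul_pow_eq her hre
  · exact Or.inl ⟨n + 1, Subtype.ext ((val_pow r n).trans hn)⟩
  · refine Or.inr ⟨⟨e * (c * r.1 ^ n) * e, _, rfl⟩, Subtype.ext ?_⟩
    change e * (c * r.1 ^ n) * e * r.1 = e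
    rw [mul_assoc _ e, her, mul_assoc, mul_assoc, ← pow_succ, hc, he.1.eq]

/-- If finitely many elements of `e A` sum to the primitive idempotent `e`, then one of them,
say `u`, can replace `e` in the sense that `(1 - e) + u` is invertible. -/
theorem IsPrimitiveIdempotent.exists_isUnit_one_sub_add {A ι : Type*} [Ring A] [IsArtinianRing A]
    {e : A} (he : IsPrimitiveIdempotent e) (s : Finset ι) (u : ι → A)
    (hu : ∀ i ∈ s, e * u i = u i) (hsum : ∑ i ∈ s, u i = e) :
    ∃ i ∈ s, IsUnit ((1 - e) + u i) := by
  have := he.isLocalRing_corner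
  let v (i : ι) : he.1.Corner := ⟨e * u i * e, _, rfl⟩
  have hv : ∑ i ∈ s, v i = 1 := by
    apply Subtype.ext
    have hval : (∑ i ∈ s, v i).1 = ∑ i ∈ s, (v i).1 :=
      map_sum (NonUnitalRing.corner e).subtype v s
    rw [hval]
    change ∑ i ∈ s, e * u i * e = e
    rw [← Finset.sum_mul, ← Finset.mul_sum, hsum, he.1.eq, he.1.eq]
  obtain ⟨i, hi, hunit⟩ :=
    IsLocalRing.exists_of_isUnit_sum (hv ▸ isUnit_one : IsUnit (∑ i ∈ s, v i))
  refine ⟨i, hi, ?_⟩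
  obtain ⟨t, ht, ht'⟩ := isUnit_iff_exists.mp hunit
  obtain ⟨het, hte⟩ := (Subsemigroup.mem_corner_iff he.1).mp t.2
  have hui := hu i hi
  have hut : u i * t.1 = e := by
    have h := congrArg Subtype.val ht
    change e * u i * e * t.1 = e at h
    rwa [mul_assoc, het, hui] at h
  have htu : t.1 * (u i * e) = e := by
    have h := congrArg Subtype.val ht'
    change t.1 * (e * u i * e) = e at h
    rwa [hui] at h
  have hee := he.1.eq
  refine isUnit_iff_exists.mpr ⟨(1 - e) + t.1 - t.1 * u i * (1 - e), ?_, ?_⟩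
  · have h₁ : e * (t.1 * u i) = t.1 * u i := by rw [← mul_assoc, het]
    have h₂ : u i * (t.1 * u i) = u i := by rw [← mul_assoc, hut, hui]
    simp only [mul_sub, sub_mul, mul_add, add_mul, one_mul, mul_one]
    simp only [← mul_assoc] at *
    simp only [*]
    abel
  · have h₃ : t.1 * (u i * u i) = u i := by
      nth_rewrite 2 [← hui]
      rw [← mul_assoc (u i), ← mul_assoc, htu, hui]
    simp only [mul_sub, sub_mul, mul_add, add_mul, one_mul, mul_one, mul_assoc, hee, hte, hui, htu,
      h₃]
    abel

theorem coe_decompose_smul_of_mem {A M : Type*} [Ring A] [AddCommGroup M] [Module A M]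
    {𝒜 : ℤ → AddSubgroup A} [GradedRing 𝒜] {ℳ : ℤ → AddSubgroup M} [DirectSum.Decomposition ℳ]
    (hℳ : IsGradedSMul 𝒜 ℳ) (a : A) {d : ℤ} {v : M} (hv : v ∈ ℳ d) (j : ℤ) :
    (DirectSum.decompose ℳ (a • v) j : M) = (DirectSum.decompose 𝒜 a (j - d) : A) • v := by
  induction a using DirectSum.Decomposition.inductionOn 𝒜 with
  | zero => simp
  | @homogeneous i b =>
    by_cases hij : i = j - d
    · subst hij
      have hmem := hℳ b.2 hv
      rw [sub_add_cancel] at hmem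
      rw [DirectSum.decompose_of_mem_same _ hmem, DirectSum.decompose_of_mem_same _ b.2]
    · rw [DirectSum.decompose_of_mem_ne _ (hℳ b.2 hv) (by omega),
        DirectSum.decompose_of_mem_ne _ b.2 hij, zero_smul]
  | add a b ha hb => simp [add_smul, ha, hb]

theorem smul_coe_decompose_of_mem_zero {A M : Type*} [Ring A] [AddCommGroup M] [Module A M]
    {𝒜 : ℤ → AddSubgroup A} {ℳ : ℤ → AddSubgroup M} [DirectSum.Decomposition ℳ]
    (hℳ : IsGradedSMul 𝒜 ℳ) {a : A} (ha : a ∈ 𝒜 0) (v : M) (j : ℤ) :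
    (DirectSum.decompose ℳ (a • v) j : M) = a • (DirectSum.decompose ℳ v j : M) := by
  induction v using DirectSum.Decomposition.inductionOn ℳ with
  | zero => simp
  | @homogeneous i v =>
    have hmem := hℳ ha v.2
    rw [zero_add] at hmem
    by_cases hij : i = j
    · subst hij
      rw [DirectSum.decompose_of_mem_same _ hmem, DirectSum.decompose_of_mem_same _ v.2]
    · rw [DirectSum.decompose_of_mem_ne _ hmem hij, DirectSum.decompose_of_mem_ne _ v.2 hij,
        smul_zero]
  | add v w hv hw => simp [smul_add, hv, hw]

/-- Exchange step: the component at a primitive idempotent of degree `0` of a generator of a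
graded module that is free of rank one can be made homogeneous. -/
theorem exists_bijective_toSpanSingleton_homogeneous {A M : Type*} [Ring A] [IsArtinianRing A]
    [AddCommGroup M] [Module A M] {𝒜 : ℤ → AddSubgroup A} {ℳ : ℤ → AddSubgroup M}
    [DirectSum.Decomposition ℳ] (hℳ : IsGradedSMul 𝒜 ℳ) {e : A} (he : IsPrimitiveIdempotent e)
    (he₀ : e ∈ 𝒜 0) {w : M} (hw : Function.Bijective (LinearMap.toSpanSingleton A M w)) :
    ∃ w' : M, Function.Bijective (LinearMap.toSpanSingleton A M w') ∧ (∃ d, e • w' ∈ ℳ d) ∧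
      ∀ f : A, f * e = 0 → f • w' = f • w := by
  classical
  let φ := LinearEquiv.ofBijective _ hw
  have hφ (a : A) : φ a = a • w := rfl
  let u (j : ℤ) : A := φ.symm (DirectSum.decompose ℳ (e • w) j : M)
  have huw (j : ℤ) : u j • w = (DirectSum.decompose ℳ (e • w) j : M) := φ.apply_symm_apply _
  have heu (j : ℤ) : e * u j = u j := by
    apply φ.injective
    rw [hφ, hφ, mul_smul, huw, ← smul_coe_decompose_of_mem_zero hℳ he₀, smul_smul, he.1.eq]
  obtain ⟨j, -, hj⟩ := he.exists_isUnit_one_sub_add (DirectSum.decompose ℳ (e • w)).support u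
    (fun j _ => heu j) (by
      rw [← map_sum, DirectSum.sum_support_decompose, ← hφ, φ.symm_apply_apply])
  refine ⟨((1 - e) + u j) • w, ?_, ⟨j, ?_⟩, fun f hf => ?_⟩
  · obtain ⟨g, hg⟩ := hj
    have hcomp : ⇑(LinearMap.toSpanSingleton A M (((1 - e) + u j) • w)) =
        LinearMap.toSpanSingleton A M w ∘ fun a => a * (g : A) := by
      funext a
      simp [mul_smul, hg]
    rw [hcomp]
    exact hw.comp g.mulRight_bijective
  · rw [smul_smul, mul_add, mul_sub, mul_one, he.1.eq, sub_self, zero_add, heu, huw]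
    exact SetLike.coe_mem _
  · rw [smul_smul, mul_add, mul_sub, mul_one, hf, ← heu, ← mul_assoc, hf, zero_mul, sub_zero,
      add_zero]

/-- **Classification of graded lifts of the regular module.**
Let `A` be a `ℤ`-graded left-artinian ring, `(e_x)_{x}` a complete system of
primitive pairwise orthogonal idempotents homogeneous of degree `0`, and `M` a
`ℤ`-graded `A`-module whose underlying ungraded module is isomorphic to `A`.
Then there are integers `n x` and an isomorphism of graded left `A`-modules
`M ≅ ⨁ₓ (A eₓ)(n x)`; concretely, an `A`-linear isomorphism `ψ : M ≃ A`
carrying the degree-`j` part `ℳ j` into `⨁ₓ 𝒜 (n x + j) · eₓ` for every `j`. -/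
theorem graded_lift_of_regular_module_classification
    {A : Type*} [Ring A] [IsArtinian A A]
    (𝒜 : ℤ → AddSubgroup A) [GradedRing 𝒜]
    {m : ℕ} (e : Fin m → A)
    (hprim : ∀ x, IsPrimitiveIdempotent (e x))
    (horth : ∀ x y, x ≠ y → e x * e y = 0)
    (hsum : (∑ x, e x) = 1)
    (hhom : ∀ x, e x ∈ 𝒜 0)
    {M : Type*} [AddCommGroup M] [Module A M]
    (ℳ : ℤ → AddSubgroup M) [DirectSum.Decomposition ℳ]
    (hℳ : IsGradedSMul 𝒜 ℳ)
    (hlift : Nonempty (M ≃ₗ[A] A)) :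
    ∃ (n : Fin m → ℤ) (ψ : M ≃ₗ[A] A),
      ∀ (j : ℤ), ∀ v ∈ ℳ j,
        ψ v ∈ ⨆ x : Fin m,
          (𝒜 (n x + j)).map (AddMonoidHom.mulRight (e x)) := by
  classical
  have : IsArtinianRing A := ‹IsArtinian A A›
  have homogeneous_on (s : Finset (Fin m)) :
      ∃ w : M, Function.Bijective (LinearMap.toSpanSingleton A M w) ∧
        ∀ x ∈ s, ∃ d, e x • w ∈ ℳ d := by
    induction s using Finset.induction_on with
    | empty =>
      obtain ⟨φ⟩ := hlift
      refine ⟨φ.symm 1, ?_, by simp⟩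
      convert φ.symm.bijective using 1
      funext a
      simp [← map_smul]
    | insert x s hx ih =>
      obtain ⟨w, hw, hs⟩ := ih
      obtain ⟨w', hw', hd, hf⟩ :=
        exists_bijective_toSpanSingleton_homogeneous hℳ (hprim x) (hhom x) hw
      refine ⟨w', hw', fun y hy => ?_⟩
      rcases Finset.mem_insert.mp hy with rfl | hy
      · exact hd
      · rw [hf (e y) (horth y x (ne_of_mem_of_not_mem hy hx))]
        exact hs y hy
  obtain ⟨w, hw, hd⟩ := homogeneous_on Finset.univ
  choose d hd using fun x => hd x (Finset.mem_univ x)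
  let φ := LinearEquiv.ofBijective _ hw
  have hφ (a : A) : φ a = a • w := rfl
  refine ⟨fun x => -d x, φ.symm, fun j v hv => ?_⟩
  obtain ⟨a, rfl⟩ := φ.surjective v
  have ha : a = ∑ x, (DirectSum.decompose 𝒜 a (j - d x) : A) * e x := by
    apply φ.injective
    have hsplit : φ a = ∑ x, a • e x • w := by
      rw [← Finset.smul_sum, ← Finset.sum_smul, hsum, one_smul, hφ]
    rw [← DirectSum.decompose_of_mem_same ℳ hv, hsplit, DirectSum.decompose_sum,
      DFinsupp.finsetSum_apply, AddSubmonoidClass.coe_finsetSum, map_sum]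
    refine Finset.sum_congr rfl fun x _ => ?_
    rw [coe_decompose_smul_of_mem hℳ a (hd x), hφ, mul_smul]
  rw [LinearEquiv.symm_apply_apply, ha]
  refine AddSubgroup.sum_mem _ fun x _ => ?_
  refine (le_iSup (fun x => (𝒜 (-d x + j)).map (AddMonoidHom.mulRight (e x))) x) ?_
  refine ⟨_, ?_, rfl⟩
  rw [neg_add_eq_sub]
  exact SetLike.coe_mem _
end

section
/- Let A be a left-artinian ring with two ℤ-gradings à and Â. The following are equivalent: (1) there exists a ℤ-grading on the abelian group A making it a graded Â-Ã-bimodule (for left multiplication graded over Â and right multiplication graded over Ã); (2) there exists a complete system of primitive pairwise orthogonal idempotents (e_x)_{x∈I} homogeneous for Â, a unit u ∈ A^×, and a function n : I → ℤ such that for all i, Ã_i = ⊕_{x,y∈I} u e_x Â_{n(x)−n(y)+i} e_y u^{-1}. -/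
open DirectSum

section Primitive

variable {A : Type*} [Ring A]

/-- `IsPrimitiveIn R e` says that `e` is an idempotent of the subring `R` and that `0` and `e`
are the only, distinct, idempotents of the corner ring `e R e`. -/
structure IsPrimitiveIn (R : Subring A) (e : A) : Prop where
  mem : e ∈ R
  idem : e * e = e
  ne_zero : e ≠ 0
  eq_zero_or_eq : ∀ p ∈ R, p * p = p → e * p = p → p * e = p → p = 0 ∨ p = e

lemma IsPrimitiveIdempotent.isPrimitiveIn_top {e : A} (h : IsPrimitiveIdempotent e) :
    IsPrimitiveIn ⊤ e := by
  obtain ⟨h1, h2, h3⟩ := h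
  refine ⟨trivial, h1, h2, fun p _ hp hep hpe => ?_⟩
  have hcompl : IsIdempotentElem (e - p) := by
    simp only [IsIdempotentElem, mul_sub, sub_mul, hep, hpe, hp, h1.eq]
    abel
  rcases h3 p (e - p) hp hcompl (by rw [mul_sub, hpe, hp, sub_self])
    (by rw [sub_mul, hep, hp, sub_self]) (by abel) with h | h
  · exact Or.inl h
  · exact Or.inr (sub_eq_zero.mp h).symm

lemma IsPrimitiveIn.isPrimitiveIdempotent {e : A} (h : IsPrimitiveIn ⊤ e) :
    IsPrimitiveIdempotent e := by
  refine ⟨h.idem, h.ne_zero, fun a b ha hb hab hba he => ?_⟩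
  rcases h.eq_zero_or_eq a trivial ha (by rw [he, add_mul, ha.eq, hba, add_zero])
    (by rw [he, mul_add, ha.eq, hab, add_zero]) with h0 | h0
  · exact Or.inl h0
  · exact Or.inr (by simpa [h0] using he)

/-- A factorization of a nonzero idempotent `x` through a primitive idempotent `y` exhibits an
isomorphism between `x` and `y`. -/
lemma IsPrimitiveIn.mul_eq_of_mul_eq {R : Subring A} {x y α β : A} (hy : IsPrimitiveIn R y)
    (hx0 : x ≠ 0) (hx : x * x = x) (hαβ : α * β = x) (hxα : x * α = α) (hαy : α * y = α)
    (hyβ : y * β = β) (hR : β * α ∈ R) : β * α = y := by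
  refine (hy.eq_zero_or_eq _ hR ?_ ?_ ?_).resolve_left fun h => hx0 ?_
  · rw [mul_assoc, ← mul_assoc α, hαβ, hxα]
  · rw [← mul_assoc, hyβ]
  · rw [mul_assoc, hαy]
  · rw [← hx, ← hαβ, mul_assoc, ← mul_assoc β, h, zero_mul, mul_zero]

lemma not_isNilpotent_and_isNilpotent_sub {e a : A} (he : e * e = e) (he0 : e ≠ 0)
    (hea : e * a = a) (hae : a * e = a) : ¬ (IsNilpotent a ∧ IsNilpotent (e - a)) := by
  rintro ⟨h1, h2⟩
  have hcomm : Commute a (e - a) := by simp [Commute, SemiconjBy, sub_mul, mul_sub, hea, hae]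
  obtain ⟨n, hn⟩ := hcomm.isNilpotent_add h1 h2
  rw [add_sub_cancel] at hn
  refine he0 ?_
  rcases n with _ | n
  · rw [← mul_one e, ← pow_zero e, hn, mul_zero]
  · rwa [IsIdempotentElem.pow_succ_eq n he] at hn

lemma exists_pow_regular [IsArtinian A A] (a : A) :
    ∃ n, n ≠ 0 ∧ (∃ b, b * a ^ n * a ^ n = a ^ n) ∧ ∀ y, y * a ^ n * a ^ n = 0 → y * a ^ n = 0 := by
  have : IsArtinianRing A := ‹_›
  let φ : Module.End A A := LinearMap.toSpanSingleton A A a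
  have hφ (n : ℕ) (y : A) : (φ ^ n) y = y * a ^ n := by
    induction n generalizing y with
    | zero => simp
    | succ n ih => rw [pow_succ, Module.End.mul_apply, ih, pow_succ', ← mul_assoc]; rfl
  obtain ⟨n, hn, hn0⟩ := (LinearMap.eventually_isCompl_ker_pow_range_pow φ).and
    (Filter.eventually_ne_atTop 0) |>.exists
  refine ⟨n, hn0, ?_, fun y hy => ?_⟩
  · obtain ⟨k, hk, r, ⟨b, rfl⟩, hkr⟩ := Submodule.mem_sup.mp
      (hn.sup_eq_top ▸ Submodule.mem_top : (1 : A) ∈ _)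
    refine ⟨b, ?_⟩
    rw [LinearMap.mem_ker, hφ] at hk
    rw [hφ] at hkr
    simpa [add_mul, hk] using congrArg (· * a ^ n) hkr
  · refine Submodule.disjoint_def.mp hn.disjoint _ ?_ ⟨y, hφ n y⟩
    rw [LinearMap.mem_ker, hφ, hy]

/-- Fitting's lemma for the corner ring of a primitive idempotent, relative to a subring `R` that
is a direct summand of `A` as a right `R`-module. -/
lemma IsPrimitiveIn.isNilpotent_or_exists_inv [IsArtinian A A] {R : Subring A} {e a : A}
    (he : IsPrimitiveIn R e) (π : A → A) (hπ : ∀ x, π x ∈ R)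
    (hπmul : ∀ x, ∀ c ∈ R, π (x * c) = π x * c) (hπid : ∀ c ∈ R, π c = c)
    (ha : a ∈ R) (hea : e * a = a) (hae : a * e = a) :
    IsNilpotent a ∨ ∃ b ∈ R, e * b = b ∧ b * e = b ∧ b * a = e ∧ a * b = e := by
  obtain ⟨n, hn, ⟨b₀, hb₀⟩, hreg⟩ := exists_pow_regular a
  obtain ⟨k, rfl⟩ := Nat.exists_eq_succ_of_ne_zero hn
  set c := a ^ (k + 1) with hc
  have hcR : c ∈ R := R.pow_mem ha _
  have hec : e * c = c := by rw [hc, pow_succ', ← mul_assoc, hea]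
  have hce : c * e = c := by rw [hc, pow_succ, mul_assoc, hae]
  have hπb : π b₀ * c * c = c := by
    rw [← hπmul _ _ hcR, ← hπmul _ _ hcR, hb₀, hπid _ hcR]
  set b := e * π b₀ with hb
  have heb : e * b = b := by rw [hb, ← mul_assoc, he.idem]
  have hbR : b ∈ R := R.mul_mem he.mem (hπ _)
  have hbcc : b * c * c = c := by rw [hb, mul_assoc, mul_assoc, ← mul_assoc (π b₀), hπb, hec]
  have hcbc : c * b * c = c := by
    refine sub_eq_zero.mp ?_
    rw [← hreg (c * b - 1) (by linear_combination (norm := noncomm_ring) c * hbcc)]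
    noncomm_ring
  rcases he.eq_zero_or_eq (b * c) (R.mul_mem hbR hcR)
    (by rw [mul_assoc, ← mul_assoc c, hcbc]) (by rw [← mul_assoc, heb])
    (by rw [mul_assoc, hce]) with h | h
  · exact Or.inl ⟨k + 1, by rw [← hc, ← hcbc, mul_assoc, h, mul_zero]⟩
  · right
    have hbR' : b * a ^ k * e ∈ R := R.mul_mem (R.mul_mem hbR (R.pow_mem ha _)) he.mem
    have hinv : b * a ^ k * e * a = e := by
      rw [mul_assoc _ e, hea, mul_assoc, ← pow_succ, h]
    have heb' : e * (b * a ^ k * e) = b * a ^ k * e := by simp only [← mul_assoc, heb]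
    exact ⟨_, hbR', heb', by rw [mul_assoc, he.idem], hinv,
      he.mul_eq_of_mul_eq he.ne_zero he.idem hinv heb' (by rw [mul_assoc, he.idem]) hea
        (R.mul_mem ha hbR')⟩

end Primitive

section Graded

variable {A : Type*} [Ring A]

/-- An additive map that is homogeneous of degree `k` commutes with taking components. -/
lemma decompose_map_apply (X Y : ℤ → AddSubgroup A) [Decomposition X] [Decomposition Y]
    (φ : A →+ A) (k : ℤ) (hφ : ∀ i, ∀ x ∈ X i, φ x ∈ Y (i + k)) (w : A) (i : ℤ) :
    (decompose Y (φ w) (i + k) : A) = φ (decompose X w i) := by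
  induction w using Decomposition.inductionOn X with
  | zero => simp
  | @homogeneous j m =>
    rcases eq_or_ne j i with rfl | hji
    · rw [decompose_of_mem_same Y (hφ _ _ m.2), decompose_of_mem_same X m.2]
    · rw [decompose_of_mem_ne Y (hφ _ _ m.2) (by simpa using hji),
        decompose_of_mem_ne X m.2 hji, map_zero]
  | add a b ha hb => simp [decompose_add, ha, hb]

variable (ℬ : ℤ → AddSubgroup A)

lemma exists_least_component [Decomposition ℬ] {y : A} (hy : y ≠ 0) :
    ∃ m, (decompose ℬ y m : A) ≠ 0 ∧ ∀ j < m, (decompose ℬ y j : A) = 0 := by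
  classical
  have hs : (decompose ℬ y).support.Nonempty := by
    rw [Finset.nonempty_iff_ne_empty]
    intro h
    refine hy ?_
    rw [← sum_support_decompose ℬ y, h, Finset.sum_empty]
  obtain ⟨m, hm, hmin⟩ := Finset.exists_min_image _ id hs
  refine ⟨m, by simpa using hm, fun j hj => ?_⟩
  by_contra hne
  exact absurd (hmin j (by simpa using hne)) (not_le.mpr hj)

lemma exists_greatest_component [Decomposition ℬ] {y : A} (hy : y ≠ 0) :
    ∃ m, (decompose ℬ y m : A) ≠ 0 ∧ ∀ j > m, (decompose ℬ y j : A) = 0 := by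
  classical
  have hs : (decompose ℬ y).support.Nonempty := by
    rw [Finset.nonempty_iff_ne_empty]
    intro h
    refine hy ?_
    rw [← sum_support_decompose ℬ y, h, Finset.sum_empty]
  obtain ⟨m, hm, hmax⟩ := Finset.exists_max_image _ id hs
  refine ⟨m, by simpa using hm, fun j hj => ?_⟩
  by_contra hne
  exact absurd (hmax j (by simpa using hne)) (not_le.mpr hj)

variable [GradedRing ℬ]

variable {ℬ}

lemma coe_decompose_mul_right {d : ℤ} {a : A} (ha : a ∈ ℬ d) (y : A) (i : ℤ) :
    (decompose ℬ (y * a) i : A) = decompose ℬ y (i - d) * a := by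
  rw [← coe_decompose_mul_add_of_right_mem ℬ ha, sub_add_cancel]

lemma not_exists_inv_of_pos [IsArtinian A A] {e a b : A} {d : ℤ} (hd : 0 < d) (he : e ∈ ℬ 0)
    (he0 : e ≠ 0) (ha : a ∈ ℬ d) (hea : e * a = a) (hae : a * e = a) (hab : a * b = e) : False := by
  have hcomp (y : A) (i : ℤ) : (decompose ℬ (y * (1 + a)) i : A) =
      decompose ℬ y i + decompose ℬ y (i - d) * a := by
    rw [mul_add, mul_one, decompose_add, DirectSum.add_apply, AddSubgroup.coe_add,
      coe_decompose_mul_right ha]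
  have hinj : Function.Injective (LinearMap.toSpanSingleton A A (1 + a)) := by
    rw [injective_iff_map_eq_zero]
    intro y hy
    by_contra hy0
    obtain ⟨m, hm, hlt⟩ := exists_least_component ℬ hy0
    refine hm ?_
    have := hcomp y m
    rw [hlt (m - d) (by lia), zero_mul, add_zero] at this
    rw [← this]
    rw [LinearMap.toSpanSingleton_apply, smul_eq_mul] at hy
    simp [hy]
  obtain ⟨y, hy⟩ := IsArtinian.surjective_of_injective_endomorphism _ hinj e
  have hye : y * e = y := by
    refine hinj ?_
    rw [LinearMap.toSpanSingleton_apply, smul_eq_mul] at hy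
    have hee : e * e = e := by
      nth_rw 2 [← hab]
      rw [← mul_assoc, hea, hab]
    simp only [LinearMap.toSpanSingleton_apply, smul_eq_mul]
    linear_combination (norm := noncomm_ring) y * hea - y * hae + hy * e + hee - hy
  rw [LinearMap.toSpanSingleton_apply, smul_eq_mul] at hy
  have hy0 : y ≠ 0 := by
    rintro rfl
    exact he0 (by simpa using hy.symm)
  obtain ⟨m, hm, hlt⟩ := exists_least_component ℬ hy0
  obtain ⟨M, hM, hgt⟩ := exists_greatest_component ℬ hy0
  have hm0 : m = 0 := by
    by_contra hne
    have := hcomp y m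
    rw [hlt (m - d) (by lia), zero_mul, add_zero, hy,
      decompose_of_mem_ne ℬ he (Ne.symm hne)] at this
    exact hm this.symm
  have hM0 : 0 ≤ M := by
    by_contra! hlt'
    exact hm (hgt m (by lia))
  have hMe : (decompose ℬ y M : A) * e = decompose ℬ y M := by
    rw [← coe_decompose_mul_of_right_mem_zero ℬ he, hye]
  have := hcomp y (M + d)
  rw [hgt (M + d) (by lia), zero_add, hy, decompose_of_mem_ne ℬ he (by lia),
    add_sub_cancel_right] at this
  exact hM (by rw [← hMe, ← hab, ← mul_assoc, ← this, zero_mul])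

/-- In a `ℤ`-graded left artinian ring, a corner at a homogeneous idempotent has no homogeneous
units of nonzero degree. -/
lemma not_exists_homogeneous_inv [IsArtinian A A] {e a b : A} {d : ℤ} (hd : d ≠ 0) (he : e ∈ ℬ 0)
    (he0 : e ≠ 0) (ha : a ∈ ℬ d) (hb : b ∈ ℬ (-d)) (hea : e * a = a) (hae : a * e = a)
    (heb : e * b = b) (hbe : b * e = b) (hab : a * b = e) (hba : b * a = e) : False := by
  rcases lt_or_gt_of_ne hd with h | h
  · exact not_exists_inv_of_pos (by lia) he he0 hb heb hbe hba
  · exact not_exists_inv_of_pos h he he0 ha hea hae hab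

/-- Fitting's lemma in degree zero. -/
lemma isNilpotent_or_exists_inv_gradeZero [IsArtinian A A] {e a : A}
    (he : IsPrimitiveIn (SetLike.GradeZero.subring ℬ) e) (ha : a ∈ ℬ 0) (hea : e * a = a)
    (hae : a * e = a) :
    IsNilpotent a ∨ ∃ b ∈ ℬ 0, e * b = b ∧ b * e = b ∧ b * a = e ∧ a * b = e :=
  he.isNilpotent_or_exists_inv (fun x => (decompose ℬ x 0 : A)) (fun x => (decompose ℬ x 0).2)
    (fun _ _ hc => coe_decompose_mul_of_right_mem_zero ℬ hc)
    (fun _ hc => decompose_of_mem_same ℬ hc) ha hea hae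

end Graded

section PrimitiveLift

variable {A : Type*} [Ring A] [IsArtinian A A] {ℬ : ℤ → AddSubgroup A} [GradedRing ℬ]

lemma isNilpotent_sub_decompose_zero {e f : A}
    (he : IsPrimitiveIn (SetLike.GradeZero.subring ℬ) e) (hf : f * f = f) (hef : e * f = f)
    (hfe : f * e = f) (hf0 : f ≠ 0) : IsNilpotent (e - decompose ℬ f 0 : A) := by
  have he0 : e ∈ ℬ 0 := he.mem
  have hef' (j : ℤ) : e * (decompose ℬ f j : A) = decompose ℬ f j := by
    rw [← coe_decompose_mul_of_left_mem_zero ℬ he0, hef]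
  have hfe' (j : ℤ) : (decompose ℬ f j : A) * e = decompose ℬ f j := by
    rw [← coe_decompose_mul_of_right_mem_zero ℬ he0, hfe]
  -- choose a homogeneous `x` not killed by `f` that generates a minimal left ideal
  let S : Set (Submodule A A) :=
    {L | ∃ x k, x ∈ ℬ k ∧ e * x = x ∧ f * x ≠ 0 ∧ L = Submodule.span A {x}}
  have hS : S.Nonempty := ⟨_, e, 0, he0, he.idem, by rwa [hfe], rfl⟩
  obtain ⟨L, ⟨x, k, hxk, hex, hfx, rfl⟩, hmin⟩ :=
    (wellFounded_lt (α := Submodule A A)).has_min S hS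
  have hgen {y z : A} {l : ℤ} (hz : z ∈ ℬ l) (hez : e * z = z) (hfz : f * z ≠ 0)
      (hzx : z ∈ Submodule.span A {x}) (hyx : y ∈ Submodule.span A {x}) : ∃ r, r * z = y := by
    have hle : Submodule.span A {z} ≤ Submodule.span A {x} := by simpa using hzx
    have heq := hle.eq_of_not_lt (hmin _ ⟨z, l, hz, hez, hfz, rfl⟩)
    rw [← heq] at hyx
    exact Submodule.mem_span_singleton.mp hyx
  have hkill {y : A} (hy : y ∈ ℬ k) (hey : e * y = y) (hyx : y ∈ Submodule.span A {x})
      (hfy : f * y ≠ 0) {j : ℤ} (hj : j ≠ 0) : f * (decompose ℬ f j * y) = 0 := by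
    set g := (decompose ℬ f j : A)
    have hgj : g ∈ ℬ j := (decompose ℬ f j).2
    by_contra hne
    obtain ⟨r, hr⟩ := hgen (SetLike.GradedMul.mul_mem hgj hy) (by rw [← mul_assoc, hef']) hne
      (by simpa using Submodule.smul_mem _ g hyx) hyx
    set r' := e * (decompose ℬ r (-j) : A) with hr'
    have hr'j : r' ∈ ℬ (-j) := by
      simpa using SetLike.GradedMul.mul_mem he0 (decompose ℬ r (-j)).2
    have hr'y : r' * g * y = y := by
      have h := congrArg (fun z => (decompose ℬ z k : A)) hr
      simp only [decompose_of_mem_same ℬ hy,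
        coe_decompose_mul_right (SetLike.GradedMul.mul_mem hgj hy)] at h
      rw [show k - (j + k) = -j by ring] at h
      rw [hr', mul_assoc, mul_assoc, h, hey]
    have her' : e * r' = r' := by rw [hr', ← mul_assoc, he.idem]
    have ht : r' * g ∈ ℬ 0 := by simpa using SetLike.GradedMul.mul_mem hr'j hgj
    rcases isNilpotent_or_exists_inv_gradeZero he ht (by rw [← mul_assoc, her'])
      (by rw [mul_assoc, hfe']) with ⟨N, hN⟩ | ⟨z, hz, hez, -, hzt, -⟩
    · have hpow (N : ℕ) : (r' * g) ^ N * y = y := by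
        induction N with
        | zero => simp
        | succ N ih => rw [pow_succ, mul_assoc, hr'y, ih]
      exact hfy (by rw [← hpow N, hN, zero_mul, mul_zero])
    · have hα : z * r' * e ∈ ℬ (-j) := by
        simpa using SetLike.GradedMul.mul_mem (SetLike.GradedMul.mul_mem hz hr'j) he0
      have hαg : z * r' * e * g = e := by rw [mul_assoc _ e, hef', mul_assoc, hzt]
      have heα : e * (z * r' * e) = z * r' * e := by simp only [← mul_assoc, hez]
      have hαe : z * r' * e * e = z * r' * e := by rw [mul_assoc, he.idem]
      have hgα : g * (z * r' * e) = e :=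
        he.mul_eq_of_mul_eq he.ne_zero he.idem hαg heα hαe (hef' j)
          (show g * (z * r' * e) ∈ ℬ 0 by simpa using SetLike.GradedMul.mul_mem hgj hα)
      exact not_exists_homogeneous_inv hj he0 he.ne_zero hgj hα (hef' j) (hfe' j) heα hαe hgα hαg
  have hzero {y : A} (hy : y ∈ ℬ k) (hey : e * y = y) (hyx : y ∈ Submodule.span A {x})
      (hfy : f * y ≠ 0) : f * ((e - decompose ℬ f 0) * y) = 0 := by
    classical
    have hsum : f * y = f * (decompose ℬ f 0 * y) := by
      calc f * y = f * ((∑ j ∈ (decompose ℬ f).support, (decompose ℬ f j : A)) * y) := by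
            rw [sum_support_decompose, ← mul_assoc, hf]
        _ = ∑ j ∈ (decompose ℬ f).support, f * (decompose ℬ f j * y) := by
            rw [Finset.sum_mul, Finset.mul_sum]
        _ = f * (decompose ℬ f 0 * y) := by
            refine Finset.sum_eq_single 0 (fun j _ hj => hkill hy hey hyx hfy hj) fun h => ?_
            rw [DFinsupp.notMem_support_iff] at h
            simp [h]
    rw [sub_mul, mul_sub, hey, ← hsum, sub_self]
  rcases isNilpotent_or_exists_inv_gradeZero he (a := e - decompose ℬ f 0)
      ((ℬ 0).sub_mem he0 (decompose ℬ f 0).2) (by rw [mul_sub, he.idem, hef'])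
      (by rw [sub_mul, he.idem, hfe']) with h | ⟨s, hs, hes, -, -, hgs⟩
  · exact h
  exfalso
  have hxx := Submodule.mem_span_singleton_self (R := A) x
  have hsx : s * x ∈ ℬ k := by simpa using SetLike.GradedMul.mul_mem hs hxk
  have hesx : e * (s * x) = s * x := by rw [← mul_assoc, hes]
  have hsxx : s * x ∈ Submodule.span A {x} := Submodule.smul_mem _ s hxx
  have hgsx : (e - decompose ℬ f 0 : A) * (s * x) = x := by rw [← mul_assoc, hgs, hex]
  by_cases hfs : f * (s * x) = 0
  · have h := hzero ((ℬ k).add_mem hxk hsx) (by rw [mul_add, hex, hesx])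
      (Submodule.add_mem _ hxx hsxx) (by rwa [mul_add, hfs, add_zero])
    rw [mul_add, mul_add, hzero hxk hex hxx hfx, hgsx, zero_add] at h
    exact hfx h
  · have h := hzero hsx hesx hsxx hfs
    rw [hgsx] at h
    exact hfx h

/-- In a `ℤ`-graded left artinian ring, an idempotent that is primitive in degree zero is
primitive. -/
lemma IsPrimitiveIn.isPrimitiveIdempotent_of_gradeZero {e : A}
    (he : IsPrimitiveIn (SetLike.GradeZero.subring ℬ) e) : IsPrimitiveIdempotent e := by
  refine IsPrimitiveIn.isPrimitiveIdempotent
    ⟨trivial, he.idem, he.ne_zero, fun f _ hf hef hfe => ?_⟩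
  by_contra! h
  have h1 := isNilpotent_sub_decompose_zero he hf hef hfe h.1
  have h2 := isNilpotent_sub_decompose_zero he (f := e - f)
    (by simp only [mul_sub, sub_mul, he.idem, hef, hfe, hf]; abel)
    (by rw [mul_sub, he.idem, hef]) (by rw [sub_mul, he.idem, hfe]) (sub_ne_zero.mpr h.2.symm)
  have he0 : e ∈ ℬ 0 := he.mem
  have hfe0 : (decompose ℬ f 0 : A) * e = decompose ℬ f 0 := by
    rw [← coe_decompose_mul_of_right_mem_zero ℬ he0, hfe]
  have hef0 : e * (decompose ℬ f 0 : A) = decompose ℬ f 0 := by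
    rw [← coe_decompose_mul_of_left_mem_zero ℬ he0, hef]
  rw [decompose_sub, DirectSum.sub_apply, AddSubgroup.coe_sub, decompose_of_mem_same ℬ he0,
    sub_sub_cancel] at h2
  exact not_isNilpotent_and_isNilpotent_sub he.idem he.ne_zero hef0 hfe0 ⟨h2, h1⟩

end PrimitiveLift

section KrullSchmidt

variable {A : Type*} [Ring A]

lemma span_singleton_lt_of_idempotent {e p : A} (hp : p * p = p) (hep : e * p = p)
    (hpe : p * e = p) (hne : p ≠ e) : Submodule.span A {p} < Submodule.span A {e} := by
  refine lt_of_le_of_ne ?_ fun h => hne ?_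
  · rw [Submodule.span_singleton_le_iff_mem]
    exact Submodule.mem_span_singleton.mpr ⟨p, hpe⟩
  · obtain ⟨r, hr⟩ := Submodule.mem_span_singleton.mp
      (h ▸ Submodule.mem_span_singleton_self e : e ∈ Submodule.span A {p})
    rw [smul_eq_mul] at hr
    rw [← hep, ← hr, mul_assoc, hp]

/-- The elements `α ∈ x A y` and `β ∈ y A x` are mutually inverse isomorphisms between the
idempotents `x` and `y`. -/
def IdempotentIso (x y α β : A) : Prop :=
  x * α = α ∧ α * y = α ∧ y * β = β ∧ β * x = β ∧ α * β = x ∧ β * α = y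

lemma mul_sum_eq_self {S : Finset A} {s : A} (hs : s ∈ S) (hidem : s * s = s)
    (horth : ∀ t ∈ S, s ≠ t → s * t = 0) : s * ∑ t ∈ S, t = s := by
  rw [Finset.mul_sum, Finset.sum_eq_single s (fun t ht hne => horth t ht hne.symm)
    (fun h => absurd hs h), hidem]

/-- The Schur complement of an invertible corner of an isomorphism is an isomorphism between the
complementary idempotents. -/
lemma IdempotentIso.schur_complement {x y E F a b β : A} (hxE : x * E = 0)
    (hFy : F * y = 0) (hE : E * E = E) (hF : F * F = F)
    (h : IdempotentIso (x + E) (y + F) a b) (hαβ : IdempotentIso x y (x * a * y) β) :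
    IdempotentIso E F (E * a * F - E * a * β * a * F) (F * b * E) := by
  obtain ⟨-, -, hb1, hb2, hab, hba⟩ := h
  obtain ⟨-, -, hyβ, hβx, hαβ, hβα⟩ := hαβ
  have hβay : β * a * y = y := by rw [← hβx, mul_assoc, mul_assoc, ← mul_assoc x, hβα]
  have hxaβ : x * a * β = x := by rw [← hyβ, ← mul_assoc, hαβ]
  have hβE : β * E = 0 := by rw [← hβx, mul_assoc, hxE, mul_zero]
  have hFβ : F * β = 0 := by rw [← hyβ, ← mul_assoc, hFy, zero_mul]
  have hFb : F * b = b - y * b := by rw [eq_sub_iff_add_eq', ← add_mul, hb1]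
  have hbE : b * E = b - b * x := by rw [eq_sub_iff_add_eq', ← mul_add, hb2]
  refine ⟨?_, ?_, ?_, ?_, ?_, ?_⟩
  · simp only [mul_sub, ← mul_assoc, hE]
  · simp only [sub_mul, mul_assoc, hF]
  · simp only [← mul_assoc, hF]
  · simp only [mul_assoc, hE]
  · have h1 : a * F * b * E = E - a * y * b * E := by
      rw [mul_assoc a, hFb, mul_sub, hab, sub_mul, add_mul, hxE, hE, zero_add]
      simp only [mul_assoc]
    have h2 : β * a * F * b * E = -(y * b * E) := by
      rw [mul_assoc _ F, hFb, mul_sub, mul_assoc β, hab, ← mul_assoc, hβay, sub_mul, mul_assoc,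
        add_mul, hxE, hE, zero_add, hβE, zero_sub]
    linear_combination (norm := noncomm_ring) E * h1 - E * a * h2 + hE
      + E * a * hF * b * E - E * a * β * a * hF * b * E
  · have h1 : F * b * E * a = F * (y + F) - F * b * x * a := by
      rw [mul_assoc F, hbE, mul_sub, sub_mul, mul_assoc F b a, hba, ← mul_assoc F]
    have h2 : F * b * E * a * β = -(F * b * x) := by
      rw [h1, sub_mul, mul_add, hFy, hF, zero_add, hFβ, zero_sub, mul_assoc _ a, mul_assoc _ x,
        ← mul_assoc x, hxaβ]
    linear_combination (norm := noncomm_ring) h1 * F - h2 * a * F + hFy * F + hF * F + hF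
      + F * b * hE * a * F - F * b * hE * a * β * a * F

variable [IsArtinian A A]

/-- Every idempotent of a subring `R` of a left artinian ring is a sum of pairwise orthogonal
primitive idempotents of `R`. -/
lemma exists_finset_isPrimitiveIn (R : Subring A) {e : A} (heR : e ∈ R) (he : e * e = e) :
    ∃ S : Finset A, (∀ s ∈ S, IsPrimitiveIn R s ∧ e * s = s ∧ s * e = s) ∧
      (∀ s ∈ S, ∀ t ∈ S, s ≠ t → s * t = 0) ∧ ∑ s ∈ S, s = e := by
  classical
  induction hL : Submodule.span A {e} using WellFoundedLT.induction generalizing e with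
  | ind L ih =>
  subst hL
  by_cases he0 : e = 0
  · exact ⟨∅, by simp, by simp, by simp [he0]⟩
  by_cases hprim : IsPrimitiveIn R e
  · refine ⟨{e}, by simpa [he] using hprim, ?_, by simp⟩
    simp only [Finset.mem_singleton]
    rintro s rfl t rfl h
    exact absurd rfl h
  obtain ⟨p, hpR, hp, hep, hpe, hp0, hne⟩ :
      ∃ p ∈ R, p * p = p ∧ e * p = p ∧ p * e = p ∧ p ≠ 0 ∧ p ≠ e := by
    by_contra! h
    refine hprim ⟨heR, he, he0, fun p hpR hp hep hpe => ?_⟩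
    by_cases hp0 : p = 0
    · exact Or.inl hp0
    · exact Or.inr (h p hpR hp hep hpe hp0)
  have hq : (e - p) * (e - p) = e - p := by
    simp only [mul_sub, sub_mul, he, hep, hpe, hp]; abel
  have heq : e * (e - p) = e - p := by rw [mul_sub, he, hep]
  have hqe : (e - p) * e = e - p := by rw [sub_mul, he, hpe]
  have hpq : p * (e - p) = 0 := by rw [mul_sub, hpe, hp, sub_self]
  have hqp : (e - p) * p = 0 := by rw [sub_mul, hep, hp, sub_self]
  obtain ⟨S, hS, hSo, hSs⟩ := ih _ (span_singleton_lt_of_idempotent hp hep hpe hne) hpR hp rfl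
  obtain ⟨T, hT, hTo, hTs⟩ := ih _ (span_singleton_lt_of_idempotent hq heq hqe
    (by simpa using hp0)) (R.sub_mem heR hpR) hq rfl
  have hST : ∀ s ∈ S, ∀ t ∈ T, s * t = 0 := fun s hs t ht => by
    rw [← (hS s hs).2.2, ← (hT t ht).2.1, mul_assoc, ← mul_assoc p, hpq, zero_mul, mul_zero]
  have hTS : ∀ t ∈ T, ∀ s ∈ S, t * s = 0 := fun t ht s hs => by
    rw [← (hT t ht).2.2, ← (hS s hs).2.1, mul_assoc, ← mul_assoc _ p, hqp, zero_mul, mul_zero]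
  have hdisj : Disjoint S T := by
    rw [Finset.disjoint_left]
    intro s hs ht
    exact (hS s hs).1.ne_zero (by rw [← (hS s hs).1.idem, hST s hs s ht])
  refine ⟨S ∪ T, ?_, ?_, by rw [Finset.sum_union hdisj, hSs, hTs, add_sub_cancel]⟩
  · intro s hs
    rcases Finset.mem_union.mp hs with h | h
    · refine ⟨(hS s h).1, ?_, ?_⟩
      · rw [← (hS s h).2.1, ← mul_assoc, hep]
      · rw [← (hS s h).2.2, mul_assoc, hpe]
    · refine ⟨(hT s h).1, ?_, ?_⟩
      · rw [← (hT s h).2.1, ← mul_assoc, heq]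
      · rw [← (hT s h).2.2, mul_assoc, hqe]
  · intro s hs t ht hst
    rcases Finset.mem_union.mp hs with h | h <;> rcases Finset.mem_union.mp ht with h' | h'
    · exact hSo s h t h' hst
    · exact hST s h t h'
    · exact hTS s h t h'
    · exact hTo s h t h' hst

lemma IsPrimitiveIdempotent.isNilpotent_or_exists_inv {e a : A} (he : IsPrimitiveIdempotent e)
    (hea : e * a = a) (hae : a * e = a) :
    IsNilpotent a ∨ ∃ b, e * b = b ∧ b * e = b ∧ b * a = e ∧ a * b = e := by
  simpa using he.isPrimitiveIn_top.isNilpotent_or_exists_inv id (by simp) (by simp) (by simp)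
    (Subring.mem_top a) hea hae

/-- If a finite sum of elements of the local ring `e A e` is invertible, then so is one of the
summands. -/
lemma IsPrimitiveIdempotent.exists_inv_of_sum {e : A} (he : IsPrimitiveIdempotent e)
    {ι : Type*} (s : Finset ι) (a : ι → A) (ha : ∀ i ∈ s, e * a i = a i ∧ a i * e = a i)
    (z : A) (hez : e * z = z) (hz : z * ∑ i ∈ s, a i = e) :
    ∃ i ∈ s, ∃ b, e * b = b ∧ b * e = b ∧ b * a i = e ∧ a i * b = e := by
  classical
  have hee : e * e = e := he.1
  induction s using Finset.induction_on generalizing z with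
  | empty => exact absurd (by simpa using hz.symm) he.2.1
  | insert i s hi ih =>
    rw [Finset.sum_insert hi, mul_add] at hz
    obtain ⟨hei, hie⟩ := ha i (Finset.mem_insert_self i s)
    have hec : e * (z * a i) = z * a i := by rw [← mul_assoc, hez]
    have hce : z * a i * e = z * a i := by rw [mul_assoc, hie]
    rcases he.isNilpotent_or_exists_inv hec hce with hnil | ⟨y, hey, -, hy, -⟩
    · rcases he.isNilpotent_or_exists_inv (a := e - z * a i) (by rw [mul_sub, hee, hec])
        (by rw [sub_mul, hee, hce]) with hnil' | ⟨y, hey, -, hy, -⟩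
      · exact absurd ⟨hnil, hnil'⟩
          (not_isNilpotent_and_isNilpotent_sub hee he.2.1 hec hce)
      · obtain ⟨j, hj, h⟩ := ih (fun j hj => ha j (Finset.mem_insert_of_mem hj)) (y * z)
          (by rw [← mul_assoc, hey]) (by rw [mul_assoc, ← hy, ← hz, add_sub_cancel_left])
        exact ⟨j, Finset.mem_insert_of_mem hj, h⟩
    · have heb : e * (y * z * e) = y * z * e := by simp only [← mul_assoc, hey]
      have hbe : y * z * e * e = y * z * e := by rw [mul_assoc, hee]
      have hb : y * z * e * a i = e := by rw [mul_assoc _ e, hei, mul_assoc, hy]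
      exact ⟨i, Finset.mem_insert_self i s, _, heb, hbe, hb,
        he.isPrimitiveIn_top.mul_eq_of_mul_eq he.2.1 hee hb heb hbe hei trivial⟩

/-- Krull–Schmidt: isomorphic sums of orthogonal primitive idempotents have, up to a bijection,
isomorphic summands. -/
lemma exists_bijOn_idempotentIso (S T : Finset A)
    (hS : ∀ s ∈ S, IsPrimitiveIdempotent s) (hSo : ∀ s ∈ S, ∀ t ∈ S, s ≠ t → s * t = 0)
    (hT : ∀ s ∈ T, IsPrimitiveIdempotent s) (hTo : ∀ s ∈ T, ∀ t ∈ T, s ≠ t → s * t = 0)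
    (a b : A) (hab : IdempotentIso (∑ s ∈ S, s) (∑ t ∈ T, t) a b) :
    ∃ σ : A → A, Set.BijOn σ S T ∧ ∀ s ∈ S, ∃ α β, IdempotentIso s (σ s) α β := by
  classical
  induction S using Finset.induction_on generalizing T a b with
  | empty =>
    obtain ⟨h1, -, -, -, -, h6⟩ := hab
    have hT0 : T = ∅ := by
      refine Finset.eq_empty_of_forall_notMem fun t ht => (hT t ht).2.1 ?_
      rw [← mul_sum_eq_self ht (hT t ht).1 (hTo t ht), ← h6, ← h1]
      simp
    subst hT0
    exact ⟨id, by simp, by simp⟩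
  | insert x S hxS ih =>
    have hx := hS x (Finset.mem_insert_self x S)
    have hxx : x * x = x := hx.1
    have hxsum := mul_sum_eq_self (Finset.mem_insert_self x S) hx.1
      (hSo x (Finset.mem_insert_self x S))
    obtain ⟨y, hy, z, hxz, hzx, hz1, hz2⟩ : ∃ y ∈ T, ∃ z, x * z = z ∧ z * x = z ∧
        z * (x * a * y * b * x) = x ∧ x * a * y * b * x * z = x := by
      refine hx.exists_inv_of_sum T (fun y => x * a * y * b * x) (fun y _ => ⟨?_, ?_⟩) x hxx ?_
      · simp only [← mul_assoc, hxx]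
      · simp only [mul_assoc, hxx]
      · rw [← Finset.sum_mul, ← Finset.sum_mul, ← Finset.mul_sum, mul_assoc x a, hab.2.1,
          mul_assoc x a, hab.2.2.2.2.1, hxsum, hxx, hxx]
    have hyy : y * y = y := (hT y hy).1
    have hiso : IdempotentIso x y (x * a * y) (y * b * x * z) := by
      have h1 : x * (x * a * y) = x * a * y := by simp only [← mul_assoc, hxx]
      have h2 : x * a * y * y = x * a * y := by rw [mul_assoc, hyy]
      have h3 : y * (y * b * x * z) = y * b * x * z := by simp only [← mul_assoc, hyy]
      have h4 : x * a * y * (y * b * x * z) = x := by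
        simp only [← mul_assoc, h2]
        exact hz2
      exact ⟨h1, h2, h3, by rw [mul_assoc, hzx], h4,
        (hT y hy).isPrimitiveIn_top.mul_eq_of_mul_eq hx.2.1 hxx h4 h1 h2 h3 trivial⟩
    have hSne : ∀ s ∈ S, s ≠ x := fun s hs h => hxS (h ▸ hs)
    have hSo' : ∀ s ∈ S, ∀ t ∈ S, s ≠ t → s * t = 0 := fun s hs t ht =>
      hSo s (Finset.mem_insert_of_mem hs) t (Finset.mem_insert_of_mem ht)
    have hTo' : ∀ s ∈ T.erase y, ∀ t ∈ T.erase y, s ≠ t → s * t = 0 := fun s hs t ht =>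
      hTo s (Finset.mem_of_mem_erase hs) t (Finset.mem_of_mem_erase ht)
    have hsum_idem {U : Finset A} (hU : ∀ s ∈ U, IsPrimitiveIdempotent s)
        (hUo : ∀ s ∈ U, ∀ t ∈ U, s ≠ t → s * t = 0) : (∑ s ∈ U, s) * ∑ s ∈ U, s = ∑ s ∈ U, s := by
      rw [Finset.sum_mul]
      exact Finset.sum_congr rfl fun s hs => mul_sum_eq_self hs (hU s hs).1 (hUo s hs)
    have hS' : ∀ s ∈ S, IsPrimitiveIdempotent s := fun s hs => hS s (Finset.mem_insert_of_mem hs)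
    have hT' : ∀ s ∈ T.erase y, IsPrimitiveIdempotent s := fun s hs =>
      hT s (Finset.mem_of_mem_erase hs)
    rw [Finset.sum_insert hxS, ← Finset.add_sum_erase T (fun t => t) hy] at hab
    obtain ⟨σ, hσ, hσiso⟩ := ih (T.erase y) hS' hSo' hT' hTo' _ _
      (IdempotentIso.schur_complement (x := x) (y := y)
        (by
          rw [Finset.mul_sum]
          exact Finset.sum_eq_zero fun s hs => hSo x (Finset.mem_insert_self x S) s
            (Finset.mem_insert_of_mem hs) (hSne s hs).symm)
        (by
          rw [Finset.sum_mul]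
          exact Finset.sum_eq_zero fun t ht => hTo t (Finset.mem_of_mem_erase ht) y hy
            (Finset.ne_of_mem_erase ht))
        (hsum_idem hS' hSo') (hsum_idem hT' hTo') hab hiso)
    have hσS : ∀ s ∈ S, Function.update σ x y s = σ s := fun s hs =>
      Function.update_of_ne (hSne s hs) _ _
    refine ⟨Function.update σ x y, ?_, fun s hs => ?_⟩
    · have h := (Set.BijOn.congr hσ fun s hs => (hσS s hs).symm).insert (a := x)
        (by simp)
      rw [Function.update_self] at h
      rw [Finset.coe_erase, Set.insert_sdiff_singleton,
        Set.insert_eq_of_mem (Finset.mem_coe.mpr hy)] at h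
      simpa using h
    · rcases Finset.mem_insert.mp hs with rfl | hs
      · rw [Function.update_self]
        exact ⟨_, _, hiso⟩
      · rw [hσS s hs]
        exact hσiso s hs

end KrullSchmidt

section Bimodule

variable {A : Type*} [Ring A]

/-- The degree `i` part of the grading on `A` for which `ℬ j * e y * u⁻¹` has degree `j + n y`. -/
def shiftedGrading (ℬ : ℤ → AddSubgroup A) {ι : Type*} (e : ι → A) (u : Aˣ) (n : ι → ℤ) (i : ℤ) :
    AddSubgroup A :=
  ⨅ y, (ℬ (i - n y)).comap (AddMonoidHom.mulRight (u * e y))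

lemma mem_shiftedGrading {ℬ : ℤ → AddSubgroup A} {ι : Type*} {e : ι → A} {u : Aˣ} {n : ι → ℤ}
    {i : ℤ} {w : A} : w ∈ shiftedGrading ℬ e u n i ↔ ∀ y, w * (u * e y) ∈ ℬ (i - n y) := by
  simp [shiftedGrading, AddSubgroup.mem_iInf]

variable {ℬ : ℤ → AddSubgroup A} [GradedRing ℬ] {ι : Type*} {e : ι → A} {u : Aˣ}
  {n : ι → ℤ}

lemma mul_mem_shiftedGrading (he : ∀ x, e x * e x = e x)
    (horth : ∀ x y, x ≠ y → e x * e y = 0) (he0 : ∀ x, e x ∈ ℬ 0) (y : ι) {j : ℤ} {b : A}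
    (hb : b ∈ ℬ j) : b * (e y * ((u⁻¹ : Aˣ) : A)) ∈ shiftedGrading ℬ e u n (j + n y) := by
  rw [mem_shiftedGrading]
  intro z
  have h : b * (e y * ((u⁻¹ : Aˣ) : A)) * (u * e z) = b * (e y * e z) := by
    simp only [mul_assoc, Units.inv_mul_cancel_left]
  rw [h]
  rcases eq_or_ne y z with rfl | hne
  · rw [he]
    simpa using SetLike.GradedMul.mul_mem hb (he0 y)
  · rw [horth y z hne, mul_zero]
    exact zero_mem _

lemma of_shift_congr {X : ℤ → AddSubgroup A} {i j : ℤ} (h : i = j) {a : A} (hi : a ∈ X i)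
    (hj : a ∈ X j) :
    DirectSum.of (fun i => X i) i ⟨a, hi⟩ = DirectSum.of (fun i => X i) j ⟨a, hj⟩ := by
  subst h
  rfl

lemma nonempty_decomposition_shiftedGrading [Fintype ι] (he : ∀ x, e x * e x = e x)
    (horth : ∀ x y, x ≠ y → e x * e y = 0) (hsum : ∑ x, e x = 1) (he0 : ∀ x, e x ∈ ℬ 0) :
    Nonempty (Decomposition (shiftedGrading ℬ e u n)) := by
  classical
  let ψ (y : ι) (j : ℤ) : ℬ j →+ shiftedGrading ℬ e u n (j + n y) :=
    ((AddMonoidHom.mulRight (e y * ((u⁻¹ : Aˣ) : A))).comp (ℬ j).subtype).codRestrict _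
      fun b => mul_mem_shiftedGrading he horth he0 y b.2
  let Ψ (y : ι) : (⨁ j, ℬ j) →+ ⨁ i, shiftedGrading ℬ e u n i :=
    toAddMonoid fun j => (of (fun i => shiftedGrading ℬ e u n i) (j + n y)).comp (ψ y j)
  have hΨ (y : ι) (b : A) :
      DirectSum.coeAddMonoidHom (shiftedGrading ℬ e u n) (Ψ y (decompose ℬ b)) =
      b * (e y * ((u⁻¹ : Aˣ) : A)) := by
    induction b using Decomposition.inductionOn ℬ with
    | zero => simp
    | homogeneous m =>
      rw [decompose_coe, toAddMonoid_of, AddMonoidHom.comp_apply, coeAddMonoidHom_of]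
      rfl
    | add a b ha hb => simp [decompose_add, ha, hb, add_mul]
  let D : A →+ ⨁ i, shiftedGrading ℬ e u n i := ∑ y, (Ψ y).comp
    ((decomposeAddEquiv ℬ).toAddMonoidHom.comp (AddMonoidHom.mulRight (u * e y)))
  have hD (w : A) : D w = ∑ y, Ψ y (decompose ℬ (w * (u * e y))) := by
    rw [AddMonoidHom.finsetSum_apply]
    rfl
  have hw (w : A) : ∑ y, w * (u * e y) * (e y * ((u⁻¹ : Aˣ) : A)) = w := by
    have h (y : ι) : w * (u * e y) * (e y * ((u⁻¹ : Aˣ) : A)) =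
        w * u * (e y) * ((u⁻¹ : Aˣ) : A) := by
      simp only [mul_assoc]
      rw [← mul_assoc (e y), he]
    simp_rw [h, ← Finset.sum_mul, ← Finset.mul_sum, hsum, mul_one, Units.mul_inv_cancel_right]
  refine ⟨Decomposition.ofAddHom _ D ?_ ?_⟩
  · ext w
    simp only [AddMonoidHom.comp_apply, hD, map_sum, hΨ, hw, AddMonoidHom.id_apply]
  · ext i w : 2
    have hmem := mem_shiftedGrading.mp w.2
    have hmem' (y : ι) : (w : A) * (u * e y) * (e y * ((u⁻¹ : Aˣ) : A)) ∈
        shiftedGrading ℬ e u n i := by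
      simpa using mul_mem_shiftedGrading (n := n) (u := u) he horth he0 y (hmem y)
    have h (y : ι) : Ψ y (decompose ℬ ((w : A) * (u * e y))) =
        of (fun i => shiftedGrading ℬ e u n i) i ⟨_, hmem' y⟩ := by
      rw [decompose_of_mem ℬ (hmem y), toAddMonoid_of]
      exact of_shift_congr (sub_add_cancel _ _) _ _
    simp only [AddMonoidHom.comp_apply, coeAddMonoidHom_of, hD, h, AddMonoidHom.id_apply]
    rw [← map_sum]
    congr 1
    ext
    simpa using hw w

/-- A conjugation formula relating `ℬ` and `𝒞` produces a graded bimodule structure. -/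
lemma exists_bimodule_grading_of_formula [Fintype ι] {𝒞 : ℤ → AddSubgroup A}
    (he : ∀ x, e x * e x = e x) (horth : ∀ x y, x ≠ y → e x * e y = 0) (hsum : ∑ x, e x = 1)
    (he0 : ∀ x, e x ∈ ℬ 0)
    (hC : ∀ i : ℤ, 𝒞 i = ⨆ x, ⨆ y, (ℬ (n x - n y + i)).map
      ((AddMonoidHom.mulLeft ((u : A) * e x)).comp
        (AddMonoidHom.mulRight (e y * ((u⁻¹ : Aˣ) : A))))) :
    ∃ X : ℤ → AddSubgroup A, Nonempty (Decomposition X) ∧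
      (∀ (i j : ℤ) (a x : A), a ∈ ℬ j → x ∈ X i → a * x ∈ X (j + i)) ∧
      (∀ (i j : ℤ) (x b : A), x ∈ X i → b ∈ 𝒞 j → x * b ∈ X (i + j)) := by
  refine ⟨shiftedGrading ℬ e u n, nonempty_decomposition_shiftedGrading he horth hsum he0,
    fun i j a w ha hw => ?_, fun i j w c hw hc => ?_⟩
  · rw [mem_shiftedGrading] at hw ⊢
    intro y
    rw [mul_assoc, add_sub_assoc]
    exact SetLike.GradedMul.mul_mem ha (hw y)
  · suffices h : 𝒞 j ≤ (shiftedGrading ℬ e u n (i + j)).comap (AddMonoidHom.mulLeft w) from h hc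
    rw [hC]
    refine iSup_le fun x => iSup_le fun y => ?_
    rw [AddSubgroup.map_le_iff_le_comap]
    intro b hb
    have h := mul_mem_shiftedGrading (n := n) (u := u) he horth he0 y
      (SetLike.GradedMul.mul_mem (mem_shiftedGrading.mp hw x) hb)
    rw [show i - n x + (n x - n y + j) + n y = i + j by ring] at h
    simpa [mul_assoc] using h

/-- Cancellation of a homogeneous isomorphism: `b` is homogeneous if `b * v` is. -/
lemma mem_of_mul_mem {X : ℤ → AddSubgroup A} [Decomposition X]
    (hX : ∀ (i j : ℤ) (a x : A), a ∈ ℬ j → x ∈ X i → a * x ∈ X (j + i)) {p v w b : A} {k l : ℤ}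
    (hp : p ∈ ℬ 0) (hv : v ∈ X l) (hvw : v * w = p) (hbp : b * p = b) (hbv : b * v ∈ X (k + l)) :
    b ∈ ℬ k := by
  have h := decompose_map_apply ℬ X (AddMonoidHom.mulRight v) l
    (fun i x hx => hX l i x v hx hv) b k
  simp only [AddMonoidHom.mulRight_apply, decompose_of_mem_same X hbv] at h
  have h' : b = decompose ℬ b k := by
    calc b = b * v * w := by rw [mul_assoc, hvw, hbp]
      _ = decompose ℬ b k := by
        rw [h, mul_assoc, hvw, ← coe_decompose_mul_of_right_mem_zero ℬ hp, hbp]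
  rw [h']
  exact (decompose ℬ b k).2

/-- Isomorphisms `v x : e x ≅ f x`, homogeneous in a graded bimodule, produce the conjugation
formula. -/
lemma formula_of_homogeneous_iso [Fintype ι] {𝒞 : ℤ → AddSubgroup A} [GradedRing 𝒞]
    {X : ℤ → AddSubgroup A} [Decomposition X]
    (hX : ∀ (i j : ℤ) (a x : A), a ∈ ℬ j → x ∈ X i → a * x ∈ X (j + i))
    (hX' : ∀ (i j : ℤ) (x b : A), x ∈ X i → b ∈ 𝒞 j → x * b ∈ X (i + j))
    {f : ι → A} (he : ∀ x, e x * e x = e x) (he0 : ∀ x, e x ∈ ℬ 0) (hf0 : ∀ x, f x ∈ 𝒞 0)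
    (hfsum : ∑ x, f x = 1) (hv : ∀ x, e x * ((u⁻¹ : Aˣ) : A) ∈ X (n x))
    (hfe : ∀ x, f x = u * e x * ((u⁻¹ : Aˣ) : A)) (i : ℤ) :
    𝒞 i = ⨆ x, ⨆ y, (ℬ (n x - n y + i)).map
      ((AddMonoidHom.mulLeft ((u : A) * e x)).comp
        (AddMonoidHom.mulRight (e y * ((u⁻¹ : Aˣ) : A)))) := by
  have hvw (x : ι) : e x * ((u⁻¹ : Aˣ) : A) * u = e x := by simp
  refine le_antisymm (fun c hc => ?_) ?_
  · have hcsum : c = ∑ x, ∑ y, f x * c * f y := by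
      simp_rw [← Finset.mul_sum, ← Finset.sum_mul, hfsum, one_mul, mul_one]
    rw [hcsum]
    refine sum_mem fun x _ => sum_mem fun y _ =>
      AddSubgroup.mem_iSup_of_mem x (AddSubgroup.mem_iSup_of_mem y ?_)
    have hye := he y
    have hxe := he x
    refine ⟨e x * ((u⁻¹ : Aˣ) : A) * c * u * e y, ?_, ?_⟩
    · refine mem_of_mul_mem hX (he0 y) (hv y) (hvw y) (by rw [mul_assoc, hye]) ?_
      have h := hX' _ _ _ _ (hX' _ _ _ _ (hv x) hc) (hf0 y)
      rw [hfe, add_zero] at h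
      rw [show n x - n y + i + n y = n x + i by ring]
      convert h using 1
      simp only [mul_assoc]
      rw [← mul_assoc (e y), hye]
    · simp only [AddMonoidHom.comp_apply, AddMonoidHom.coe_mulLeft, AddMonoidHom.mulRight_apply,
        hfe, mul_assoc]
      rw [← mul_assoc (e y), hye, ← mul_assoc (e x), hxe]
  · refine iSup_le fun x => iSup_le fun y => ?_
    rintro _ ⟨b, hb, rfl⟩
    simp only [AddMonoidHom.comp_apply, AddMonoidHom.coe_mulLeft, AddMonoidHom.mulRight_apply]
    set c : A := u * e x * (b * (e y * ((u⁻¹ : Aˣ) : A))) with hc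
    have hwc {k : ℤ} {w : A} (hw : w ∈ X k) : w * c ∈ X (k + i) := by
      have ha : w * u * e x ∈ ℬ (k - n x) := by
        refine mem_of_mul_mem hX (he0 x) (hv x) (hvw x) (by rw [mul_assoc, he]) ?_
        have h := hX' _ _ _ _ hw (hf0 x)
        rw [hfe, add_zero] at h
        rw [sub_add_cancel]
        convert h using 1
        simp only [mul_assoc]
        rw [← mul_assoc (e x), he]
      have h := hX _ _ _ _ (SetLike.GradedMul.mul_mem ha hb) (hv y)
      rw [show k - n x + (n x - n y + i) + n y = k + i by ring] at h
      convert h using 1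
      simp only [hc, mul_assoc]
    have hcomp (w : A) : w * c = w * decompose 𝒞 c i := by
      induction w using Decomposition.inductionOn X with
      | zero => simp
      | @homogeneous k m =>
        have h := decompose_map_apply 𝒞 X (AddMonoidHom.mulLeft (m : A)) k
          (fun j z hz => add_comm k j ▸ hX' k j m z m.2 hz) c i
        rw [AddMonoidHom.coe_mulLeft, add_comm i k, decompose_of_mem_same X (hwc m.2)] at h
        exact h
      | add a b ha hb => rw [add_mul, add_mul, ha, hb]
    have h1 := hcomp 1
    rw [one_mul, one_mul] at h1
    rw [h1]
    exact (decompose 𝒞 c i).2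

end Bimodule

/-- An isomorphism between primitive idempotents may be replaced by a homogeneous one. -/
lemma exists_homogeneous_idempotentIso {A : Type*} [Ring A] [IsArtinian A A]
    {ℬ 𝒞 X : ℤ → AddSubgroup A} [Decomposition X]
    (hX : ∀ (i j : ℤ) (a x : A), a ∈ ℬ j → x ∈ X i → a * x ∈ X (j + i))
    (hX' : ∀ (i j : ℤ) (x b : A), x ∈ X i → b ∈ 𝒞 j → x * b ∈ X (i + j)) {s t α β : A}
    (hs : IsPrimitiveIdempotent s) (hs0 : s ∈ ℬ 0) (ht : IsPrimitiveIdempotent t) (ht0 : t ∈ 𝒞 0)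
    (h : IdempotentIso s t α β) : ∃ k v w, v ∈ X k ∧ IdempotentIso s t v w := by
  classical
  obtain ⟨hsα, hαt, htβ, hβs, hαβ, -⟩ := h
  have hss : s * s = s := hs.1
  have hsα' (i : ℤ) : s * (decompose X α i : A) = decompose X α i := by
    have h := decompose_map_apply X X (AddMonoidHom.mulLeft s) 0
      (fun i x hx => add_comm 0 i ▸ hX i 0 s x hs0 hx) α i
    simp only [AddMonoidHom.coe_mulLeft, hsα] at h
    rw [add_zero] at h
    exact h.symm
  have hαt' (i : ℤ) : (decompose X α i : A) * t = decompose X α i := by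
    have h := decompose_map_apply X X (AddMonoidHom.mulRight t) 0
      (fun i x hx => hX' i 0 x t hx ht0) α i
    simp only [AddMonoidHom.mulRight_apply, hαt] at h
    rw [add_zero] at h
    exact h.symm
  obtain ⟨k, -, b, -, hbs, -, hkb⟩ := hs.exists_inv_of_sum (decompose X α).support
    (fun i => (decompose X α i : A) * β)
    (fun i _ => ⟨by rw [← mul_assoc, hsα'], by rw [mul_assoc, hβs]⟩) s hss
    (by rw [← Finset.sum_mul, sum_support_decompose, hαβ, hss])
  rw [mul_assoc] at hkb
  have htw : t * (β * b) = β * b := by rw [← mul_assoc, htβ]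
  exact ⟨k, decompose X α k, β * b, (decompose X α k).2, hsα' k, hαt' k, htw,
    by rw [mul_assoc, hbs], hkb,
    ht.isPrimitiveIn_top.mul_eq_of_mul_eq hs.2.1 hss hkb (hsα' k) (hαt' k) htw trivial⟩

/-- A left artinian `ℤ`-graded ring has a complete system of orthogonal homogeneous primitive
idempotents. -/
lemma exists_finset_homogeneous_primitive {A : Type*} [Ring A] [IsArtinian A A]
    (ℬ : ℤ → AddSubgroup A) [GradedRing ℬ] :
    ∃ S : Finset A, (∀ s ∈ S, IsPrimitiveIdempotent s ∧ s ∈ ℬ 0) ∧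
      (∀ s ∈ S, ∀ t ∈ S, s ≠ t → s * t = 0) ∧ ∑ s ∈ S, s = 1 := by
  obtain ⟨S, hS, hSo, hSs⟩ := exists_finset_isPrimitiveIn (SetLike.GradeZero.subring ℬ)
    (Subring.one_mem _) (one_mul 1)
  exact ⟨S, fun s hs => ⟨(hS s hs).1.isPrimitiveIdempotent_of_gradeZero, (hS s hs).1.mem⟩, hSo, hSs⟩

/-- **Equivalence criterion for two gradings.**
Let `A` be a left-artinian ring with two `ℤ`-gradings `𝒜̂` (written `ℬ`) and
`𝒜̃` (written `𝒞`).  The following are equivalent: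
(1) there is a `ℤ`-grading `X` of the additive group `A` making it a graded
`Â`-`Ã`-bimodule (`ℬ j * X i ⊆ X (j + i)` and `X i * 𝒞 j ⊆ X (i + j)`);
(2) there are a complete system of primitive pairwise orthogonal idempotents
`(e_x)` homogeneous for `ℬ`, a unit `u` and integers `n x` such that
`𝒞 i = ⨁_{x,y} u·e_x·ℬ (n x − n y + i)·e_y·u⁻¹` for every `i`. -/
theorem graded_bimodule_iff_idempotent_conjugation_formula
    {A : Type*} [Ring A] [IsArtinian A A]
    (ℬ : ℤ → AddSubgroup A) [GradedRing ℬ]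
    (𝒞 : ℤ → AddSubgroup A) [GradedRing 𝒞] :
    (∃ X : ℤ → AddSubgroup A,
        Nonempty (DirectSum.Decomposition X) ∧
        (∀ (i j : ℤ) (a x : A), a ∈ ℬ j → x ∈ X i → a * x ∈ X (j + i)) ∧
        (∀ (i j : ℤ) (x b : A), x ∈ X i → b ∈ 𝒞 j → x * b ∈ X (i + j)))
    ↔
    (∃ (m : ℕ) (e : Fin m → A) (u : Aˣ) (n : Fin m → ℤ),
        (∀ x, IsPrimitiveIdempotent (e x)) ∧
        (∀ x y, x ≠ y → e x * e y = 0) ∧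
        (∑ x, e x) = 1 ∧
        (∀ x, e x ∈ ℬ 0) ∧
        ∀ i : ℤ, 𝒞 i = ⨆ x : Fin m, ⨆ y : Fin m,
          (ℬ (n x - n y + i)).map
            ((AddMonoidHom.mulLeft ((u : A) * e x)).comp
              (AddMonoidHom.mulRight (e y * ((u⁻¹ : Aˣ) : A))))) := by
  classical
  constructor
  · rintro ⟨X, ⟨_⟩, hX, hX'⟩
    obtain ⟨S, hS, hSo, hSs⟩ := exists_finset_homogeneous_primitive ℬ
    obtain ⟨T, hT, hTo, hTs⟩ := exists_finset_homogeneous_primitive 𝒞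
    obtain ⟨σ, hσ, hσiso⟩ := exists_bijOn_idempotentIso S T (fun s hs => (hS s hs).1) hSo
      (fun t ht => (hT t ht).1) hTo 1 1 (by simp [IdempotentIso, hSs, hTs])
    have hσT (s : S) : σ s ∈ T := hσ.mapsTo s.2
    choose k v w hvk hvw using fun s : S =>
      have ⟨_, _, h⟩ := hσiso s s.2
      exists_homogeneous_idempotentIso hX hX' (hS s s.2).1 (hS s s.2).2 (hT _ (hσT s)).1
        (hT _ (hσT s)).2 h
    have hSs' : ∑ s : S, (s : A) = 1 := by rw [Finset.sum_coe_sort S fun s => s, hSs]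
    have hTs' : ∑ s : S, σ s = 1 := by
      rw [Finset.sum_coe_sort S σ, ← hTs]
      exact Finset.sum_nbij σ (fun _ hs => hσ.mapsTo hs) hσ.injOn hσ.surjOn fun _ _ => rfl
    have hsv (s t : S) (hst : s ≠ t) : (s : A) * v t = 0 := by
      rw [← (hvw t).1, ← mul_assoc, hSo s s.2 t t.2 (by simpa using hst), zero_mul]
    have hsv' (s : S) : (s : A) * ∑ t, v t = v s := by
      rw [Finset.mul_sum, Finset.sum_eq_single s (fun t _ hts => hsv s t hts.symm) (by simp),
        (hvw s).1]
    have hvw0 (s t : S) (hst : s ≠ t) : v s * w t = 0 := by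
      have hne : σ s ≠ σ t := fun h => hst (Subtype.ext (hσ.injOn s.2 t.2 h))
      rw [← (hvw s).2.1, ← (hvw t).2.2.1, mul_assoc, ← mul_assoc (σ s),
        hTo _ (hσT s) _ (hσT t) hne, zero_mul, mul_zero]
    have hwv0 (s t : S) (hst : s ≠ t) : w s * v t = 0 := by
      rw [← (hvw s).2.2.2.1, mul_assoc, hsv s t hst, mul_zero]
    have hvw1 : (∑ s, v s) * ∑ s, w s = 1 := by
      rw [Finset.sum_mul_sum, ← hSs']
      refine Finset.sum_congr rfl fun s _ => ?_
      rw [Finset.sum_eq_single s (fun t _ hts => hvw0 s t hts.symm) (by simp),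
        (hvw s).2.2.2.2.1]
    have hwv1 : (∑ s, w s) * ∑ s, v s = 1 := by
      rw [Finset.sum_mul_sum, ← hTs']
      refine Finset.sum_congr rfl fun s _ => ?_
      rw [Finset.sum_eq_single s (fun t _ hts => hwv0 s t hts.symm) (by simp),
        (hvw s).2.2.2.2.2]
    let φ := S.equivFin.symm
    let u : Aˣ := ⟨∑ s, w s, ∑ s, v s, hwv1, hvw1⟩
    refine ⟨S.card, fun x => φ x, u, fun x => k (φ x), fun x => (hS _ (φ x).2).1,
      fun x y hxy => hSo _ (φ x).2 _ (φ y).2 fun h => hxy (φ.injective (Subtype.ext h)),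
      (φ.sum_comp fun s : S => (s : A)).trans hSs', fun x => (hS _ (φ x).2).2, ?_⟩
    refine formula_of_homogeneous_iso (f := fun x => σ (φ x)) hX hX'
      (fun x => (hS _ (φ x).2).1.1) (fun x => (hS _ (φ x).2).2) (fun x => (hT _ (hσT (φ x))).2)
      ((φ.sum_comp fun s : S => σ s).trans hTs') (fun x => ?_) fun x => ?_
    · exact (hsv' (φ x)).symm ▸ hvk (φ x)
    · change σ (φ x) = (∑ s, w s) * (φ x : A) * ∑ s, v s
      rw [mul_assoc, hsv', Finset.sum_mul,
        Finset.sum_eq_single (φ x) (fun t _ htx => hwv0 t (φ x) htx) (by simp),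
        (hvw (φ x)).2.2.2.2.2]
  · rintro ⟨m, e, u, n, he, horth, hsum, he0, hC⟩
    exact exists_bimodule_grading_of_formula (fun x => (he x).1) horth hsum he0 hC
end
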